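/- arXiv:1206.0197 — 10 statements merged into one kernel-verified Lean document; each statement's English description precedes it below -/
import Mathlib

section
/- For every integer L ≥ 1, every real SNR > 0, all g, a ∈ ℝ^L, and all positive reals b₁², …, b_L², the infimum over β ∈ ℝ of SNR·∑_{ℓ=1}^L b_ℓ²·(β·g_ℓ − a_ℓ)² + β² is attained and equals aᵀ·(SNR⁻¹·B⁻¹ + g·gᵀ)⁻¹·a, where B = diag(b₁², …, b_L²) and the matrix SNR⁻¹·B⁻¹ + g·gᵀ is positive definite (hence invertible). -/
open Matrix Finset

/-- Completing the square: if `a ℓ = (s * b ℓ)⁻¹ * x ℓ + g ℓ * ⟨g, x⟩` for every `ℓ`, then the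
weighted least-squares objective in `β` is `⟨a, x⟩` plus a nonnegative multiple of `(β - ⟨g, x⟩) ^ 2`. -/
theorem weighted_sq_sum_add_sq_eq {ι : Type*} [Fintype ι] {s : ℝ} (hs : s ≠ 0)
    {g a b x : ι → ℝ} (hb : ∀ ℓ, b ℓ ≠ 0)
    (hx : ∀ ℓ, a ℓ = (s * b ℓ)⁻¹ * x ℓ + g ℓ * (g ⬝ᵥ x)) (β : ℝ) :
    s * (∑ ℓ, b ℓ * (β * g ℓ - a ℓ) ^ 2) + β ^ 2 =
      (1 + s * ∑ ℓ, b ℓ * g ℓ ^ 2) * (β - g ⬝ᵥ x) ^ 2 + a ⬝ᵥ x := by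
  have hgx : g ⬝ᵥ x = ∑ ℓ, g ℓ * x ℓ := rfl
  generalize g ⬝ᵥ x = t at hx hgx ⊢
  have hterm : ∀ ℓ, s * (b ℓ * (β * g ℓ - a ℓ) ^ 2) =
      (β - t) ^ 2 * (s * (b ℓ * g ℓ ^ 2)) + a ℓ * x ℓ - (2 * β - t) * (g ℓ * x ℓ) := by
    intro ℓ
    have := hb ℓ
    rw [hx ℓ]
    field_simp
    ring
  rw [mul_sum, sum_congr rfl fun ℓ _ => hterm ℓ, sum_sub_distrib, sum_add_distrib, ← mul_sum,
    ← mul_sum, ← mul_sum, ← hgx, dotProduct]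
  ring

/-- For every integer `L ≥ 1`, every real `SNR > 0`, all `g, a ∈ ℝ^L`, and positive
weights `b₁², …, b_L²`, the infimum over `β ∈ ℝ` of
`SNR·∑ b_ℓ²·(β·g_ℓ − a_ℓ)² + β²` is attained and equals `aᵀ·(SNR⁻¹·B⁻¹ + g·gᵀ)⁻¹·a`,
where `B = diag(b₁², …, b_L²)` and `SNR⁻¹·B⁻¹ + g·gᵀ` is positive definite. -/
theorem stmt1 (L : ℕ) (hL : 1 ≤ L) (SNR : ℝ) (hSNR : 0 < SNR)
    (g a : Fin L → ℝ) (b : Fin L → ℝ) (hb : ∀ ℓ, 0 < b ℓ) :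
    let B : Matrix (Fin L) (Fin L) ℝ := Matrix.diagonal b
    let M : Matrix (Fin L) (Fin L) ℝ := SNR⁻¹ • B⁻¹ + Matrix.vecMulVec g g
    M.PosDef ∧
      IsLeast (Set.range fun β : ℝ => SNR * (∑ ℓ, b ℓ * (β * g ℓ - a ℓ) ^ 2) + β ^ 2)
        (a ⬝ᵥ (M⁻¹ *ᵥ a)) := by
  intro B M
  have hM : M.PosDef := by
    have hB : B.PosDef := PosDef.diagonal hb
    have hg : (vecMulVec g g).PosSemidef := by
      simpa using posSemidef_vecMulVec_self_star g
    exact (hB.inv.smul (inv_pos.mpr hSNR)).add_posSemidef hg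
  refine ⟨hM, ?_⟩
  have hMx : M *ᵥ (M⁻¹ *ᵥ a) = a := by
    rw [mulVec_mulVec, mul_nonsing_inv _ ((isUnit_iff_isUnit_det _).mp hM.isUnit), one_mulVec]
  have hBinv : B⁻¹ = diagonal fun ℓ => (b ℓ)⁻¹ :=
    inv_eq_right_inv (by
      rw [diagonal_mul_diagonal, ← diagonal_one]
      exact congrArg diagonal (funext fun ℓ => mul_inv_cancel₀ (hb ℓ).ne'))
  generalize M⁻¹ *ᵥ a = x at hMx ⊢
  have hx : ∀ ℓ, a ℓ = (SNR * b ℓ)⁻¹ * x ℓ + g ℓ * (g ⬝ᵥ x) := by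
    intro ℓ
    rw [← congrFun hMx ℓ]
    simp only [M, hBinv, add_mulVec, smul_mulVec, vecMulVec_mulVec, Pi.add_apply, Pi.smul_apply,
      mulVec_diagonal, smul_eq_mul, MulOpposite.smul_eq_mul_unop, MulOpposite.unop_op, mul_inv]
    ring
  have hsq := weighted_sq_sum_add_sq_eq hSNR.ne' (fun ℓ => (hb ℓ).ne') hx
  refine ⟨⟨g ⬝ᵥ x, by simp [hsq]⟩, ?_⟩
  rintro _ ⟨β, rfl⟩
  simp only [hsq]
  have hnonneg : 0 ≤ ∑ ℓ, b ℓ * g ℓ ^ 2 :=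
    sum_nonneg fun ℓ _ => mul_nonneg (hb ℓ).le (sq_nonneg _)
  exact le_add_of_nonneg_left (by positivity)
end

section
/- For every integer K ≥ 1, every real SNR > 0, and every h ∈ ℝ^K, there exist K vectors a₁, …, a_K ∈ ℤ^K that are linearly independent over ℝ and satisfy ∑_{m=1}^K (1/2)·log₂(SNR / σ²_eff(h, a_m; SNR)) ≥ (1/2)·log₂(1 + ‖h‖²·SNR) − (K/2)·log₂(K). -/
open Finset

/-- Greedy choice of vectors realising the successive minima of a set `S` with finite norm balls. -/
lemma exists_linearIndependent_successive_minima {E : Type*} [NormedAddCommGroup E]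
    [NormedSpace ℝ E] [FiniteDimensional ℝ E] {S : Set E} (hS : Submodule.span ℝ S = ⊤)
    (hfin : ∀ r : ℝ, (Metric.closedBall 0 r ∩ S).Finite) (k : ℕ) (hk : k ≤ Module.finrank ℝ E) :
    ∃ v : Fin k → E, LinearIndependent ℝ v ∧ (∀ i, v i ∈ S) ∧
      ∀ i, ∀ x ∈ S, ‖x‖ < ‖v i‖ → x ∈ Submodule.span ℝ (v '' Set.Iio i) := by
  induction k with
  | zero => exact ⟨Fin.elim0, linearIndependent_empty_type, fun i => i.elim0, fun i => i.elim0⟩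
  | succ k ih =>
    obtain ⟨v, hv, hvS, hmin⟩ := ih (by omega)
    obtain ⟨x₀, hx₀S, hx₀⟩ : ∃ x ∈ S, x ∉ Submodule.span ℝ (Set.range v) := by
      by_contra! hcon
      have htop : Submodule.span ℝ (Set.range v) = ⊤ :=
        top_le_iff.1 (hS ▸ Submodule.span_le.2 hcon)
      have hle := finrank_range_le_card (R := ℝ) v
      rw [Set.finrank, htop, finrank_top, Fintype.card_fin] at hle
      omega
    obtain ⟨y, ⟨⟨-, hyS⟩, hy⟩, hymin⟩ := Set.exists_min_image
      ((Metric.closedBall 0 ‖x₀‖ ∩ S) ∩ {x | x ∉ Submodule.span ℝ (Set.range v)}) norm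
      ((hfin _).subset Set.inter_subset_left) ⟨x₀, ⟨by simp, hx₀S⟩, hx₀⟩
    refine ⟨Fin.snoc v y, linearIndependent_finSnoc.2 ⟨hv, hy⟩, ?_, ?_⟩
    · intro i
      refine Fin.lastCases ?_ (fun i => ?_) i
      · simpa using hyS
      · simpa using hvS i
    · intro i
      refine Fin.lastCases ?_ (fun i => ?_) i
      · intro x hx hlt
        rw [Fin.snoc_last] at hlt
        have hxv : x ∈ Submodule.span ℝ (Set.range v) := by
          by_contra hxv
          refine absurd hlt (not_lt.2 ?_)
          by_cases hxx : ‖x‖ ≤ ‖x₀‖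
          · exact hymin x ⟨⟨by simpa using hxx, hx⟩, hxv⟩
          · exact (hymin x₀ ⟨⟨by simp, hx₀S⟩, hx₀⟩).trans (not_le.1 hxx).le
        refine Submodule.span_mono ?_ hxv
        rintro _ ⟨l, rfl⟩
        exact ⟨l.castSucc, Fin.castSucc_lt_last l, by simp⟩
      · intro x hx hlt
        rw [Fin.snoc_castSucc] at hlt
        refine Submodule.span_mono ?_ (hmin i x hx hlt)
        rintro _ ⟨l, hl, rfl⟩
        exact ⟨l.castSucc, by simpa using hl, by simp⟩

/-- The volume of a box with sides parallel to the vectors of an orthonormal basis. -/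
lemma OrthonormalBasis.volume_abs_inner_lt {n : ℕ}
    (e : OrthonormalBasis (Fin n) ℝ (EuclideanSpace ℝ (Fin n))) (r : Fin n → ℝ) :
    MeasureTheory.volume {x | ∀ i, |inner ℝ (e i) x| < r i} = ∏ i, ENNReal.ofReal (2 * r i) := by
  have hpre : {x | ∀ i, |inner ℝ (e i) x| < r i} =
      e.repr ⁻¹' (WithLp.ofLp ⁻¹' (Set.univ.pi fun i => Set.Ioo (-r i) (r i))) := by
    ext x
    simp [abs_lt, Set.mem_pi, e.repr_apply_apply]
  have hmeas : MeasurableSet (Set.univ.pi fun i => Set.Ioo (-r i) (r i)) :=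
    MeasurableSet.univ_pi fun _ => measurableSet_Ioo
  have hof := PiLp.volume_preserving_ofLp (Fin n)
  rw [hpre, e.measurePreserving_repr.measure_preimage
    (hof.measurable hmeas).nullMeasurableSet,
    hof.measure_preimage hmeas.nullMeasurableSet, MeasureTheory.volume_pi_pi]
  simp only [Real.volume_Ioo, sub_neg_eq_add, two_mul]

/-- A form of **Minkowski's second theorem** for Euclidean lattices. -/
lemma exists_linearIndependent_prod_norm_le {n : ℕ}
    (b : Module.Basis (Fin n) ℝ (EuclideanSpace ℝ (Fin n))) :
    ∃ v : Fin n → EuclideanSpace ℝ (Fin n), LinearIndependent ℝ v ∧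
      (∀ i, v i ∈ Submodule.span ℤ (Set.range b)) ∧
      ∏ i, ‖v i‖ ≤ √n ^ n * |(EuclideanSpace.basisFun (Fin n) ℝ).toBasis.det b| := by
  obtain ⟨v, hv, hvS, hmin⟩ := exists_linearIndependent_successive_minima
    (S := (Submodule.span ℤ (Set.range b) : Set (EuclideanSpace ℝ (Fin n))))
    (top_le_iff.1 (b.span_eq ▸ Submodule.span_mono Submodule.subset_span))
    (fun r => ZSpan.setFinite_inter b Metric.isBounded_closedBall) n (by simp)
  refine ⟨v, hv, hvS, ?_⟩
  by_contra! hlt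
  set d := |(EuclideanSpace.basisFun (Fin n) ℝ).toBasis.det b| with hd
  have hn : 0 < n := by
    rcases Nat.eq_zero_or_pos n with rfl | hn
    · simp [hd, Module.Basis.det_isEmpty] at hlt
    · exact hn
  have hsn : 0 < √(n : ℝ) := Real.sqrt_pos.2 (by exact_mod_cast hn)
  let e := InnerProductSpace.gramSchmidtOrthonormalBasis (𝕜 := ℝ)
    (finrank_euclideanSpace (𝕜 := ℝ) (ι := Fin n)) v
  have horth : ∀ {i j}, i ≤ j → ∀ x, inner ℝ (e j) x ≠ 0 →
      x ∉ Submodule.span ℝ (v '' Set.Iio i) := by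
    intro i j hij x hx hmem
    refine hx ?_
    refine Submodule.span_induction (p := fun y _ => inner ℝ (e j) y = 0) ?_ (by simp)
      (fun y z _ _ hy hz => by rw [inner_add_right, hy, hz, add_zero])
      (fun c y _ hy => by rw [inner_smul_right, hy, mul_zero]) hmem
    rintro _ ⟨l, hl, rfl⟩
    exact InnerProductSpace.gramSchmidtOrthonormalBasis_inv_triangular _ v
      (lt_of_lt_of_le hl hij)
  have hF : MeasureTheory.volume (ZSpan.fundamentalDomain b) = ENNReal.ofReal d := by
    rw [ZSpan.measure_fundamentalDomain b _ (EuclideanSpace.basisFun (Fin n) ℝ).toBasis,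
      MeasureTheory.measure_congr (ZSpan.fundamentalDomain_ae_parallelepiped _ _),
      OrthonormalBasis.coe_toBasis, OrthonormalBasis.volume_parallelepiped, mul_one]
  have : Countable (Submodule.span ℤ (Set.range b)).toAddSubgroup :=
    inferInstanceAs (Countable (Submodule.span ℤ (Set.range b)))
  obtain ⟨⟨x, hxL⟩, hx0, hxs⟩ :=
    MeasureTheory.exists_ne_zero_mem_lattice_of_measure_mul_two_pow_lt_measure
      (μ := MeasureTheory.volume) (L := (Submodule.span ℤ (Set.range b)).toAddSubgroup)
      (s := {x | ∀ i, |inner ℝ (e i) x| < ‖v i‖ / √n})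
      (ZSpan.isAddFundamentalDomain b MeasureTheory.volume)
      (fun x hx i => by simpa using hx i)
      (by
        rw [Set.ofPred_forall]
        refine convex_iInter fun i => ?_
        have h := (convex_ball (0 : ℝ) (‖v i‖ / √n)).linear_preimage
          (innerSL ℝ (e i)).toLinearMap
        convert h using 1
        ext y
        simp)
      (by
        rw [e.volume_abs_inner_lt, hF, finrank_euclideanSpace_fin,
          ← ENNReal.ofReal_prod_of_nonneg (fun i _ => by positivity),
          show (2 : ENNReal) ^ n = ENNReal.ofReal (2 ^ n) by simp [ENNReal.ofReal_pow], ← ENNReal.ofReal_mul (abs_nonneg _)]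
        have hprod : ∏ i, 2 * (‖v i‖ / √n) = 2 ^ n * ((∏ i, ‖v i‖) / √n ^ n) := by
          simp [Finset.prod_mul_distrib, Finset.prod_div_distrib]
        have hdlt : d < (∏ i, ‖v i‖) / √n ^ n := by
          rwa [lt_div_iff₀' (by positivity)]
        have hd0 : 0 ≤ d := abs_nonneg _
        rw [hprod, mul_comm]
        exact (ENNReal.ofReal_lt_ofReal_iff (by
          have := hd0.trans_lt hdlt
          positivity)).2 (by gcongr))
  have hx : x ≠ 0 := fun h => hx0 (Subtype.ext h)
  have hxpos : 0 < ‖x‖ := norm_pos_iff.2 hx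
  obtain ⟨j, hj, hjmax⟩ : ∃ j, inner ℝ (e j) x ≠ 0 ∧ ∀ i, j < i → inner ℝ (e i) x = 0 := by
    have hne : (univ.filter fun i => inner ℝ (e i) x ≠ 0).Nonempty := by
      by_contra hemp
      rw [Finset.not_nonempty_iff_eq_empty, Finset.filter_eq_empty_iff] at hemp
      refine hx (e.repr.injective ?_)
      ext i
      simpa [e.repr_apply_apply] using hemp (mem_univ i)
    refine ⟨_, (Finset.mem_filter.1 (Finset.max'_mem _ hne)).2, fun i hi => ?_⟩
    by_contra hi0
    exact absurd (Finset.le_max' _ i (by simpa using hi0)) (not_le.2 hi)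
  have hcoord : ∀ i, ‖inner ℝ (e i) x‖ ^ 2 < ‖x‖ ^ 2 / n := by
    intro i
    have hlt : |inner ℝ (e i) x| < ‖x‖ / √n := by
      rcases le_or_gt i j with hij | hij
      · refine (hxs i).trans_le ?_
        gcongr
        by_contra! hcon
        exact horth hij x hj (hmin i x hxL hcon)
      · rw [hjmax i hij, abs_zero]
        positivity
    have h2 := pow_lt_pow_left₀ hlt (abs_nonneg _) two_ne_zero
    rwa [div_pow, Real.sq_sqrt (by positivity)] at h2
  have hsum : ∑ i, ‖inner ℝ (e i) x‖ ^ 2 < ∑ _i : Fin n, ‖x‖ ^ 2 / n :=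
    Finset.sum_lt_sum_of_nonempty ⟨j, mem_univ j⟩ fun i _ => hcoord i
  rw [e.sum_sq_norm_inner_right, Finset.sum_const, Finset.card_univ, Fintype.card_fin,
    nsmul_eq_mul, mul_div_cancel₀ _ (by positivity)] at hsum
  exact lt_irrefl _ hsum

/-- Minkowski's second theorem for the integer lattice and the quadratic form `‖B x‖²`. -/
lemma exists_linearIndependent_int_prod_le {n : ℕ} (B : Matrix (Fin n) (Fin n) ℝ)
    (hB : B.det ≠ 0) :
    ∃ a : Fin n → Fin n → ℤ, LinearIndependent ℝ (fun m i => (a m i : ℝ)) ∧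
      ∏ m, ∑ i, (B.mulVec (fun l => (a m l : ℝ)) i) ^ 2 ≤ (n : ℝ) ^ n * B.det ^ 2 := by
  let f : (Fin n → ℝ) ≃ₗ[ℝ] EuclideanSpace ℝ (Fin n) :=
    (Matrix.toLinearEquiv' B (B.invertibleOfIsUnitDet hB.isUnit)).trans
      (WithLp.linearEquiv 2 ℝ (Fin n → ℝ)).symm
  have hf : ∀ x i, f x i = B.mulVec x i := fun x i => rfl
  let b := (Pi.basisFun ℝ (Fin n)).map f
  have hdet : (EuclideanSpace.basisFun (Fin n) ℝ).toBasis.det b = B.det := by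
    rw [Module.Basis.det_apply]
    congr 1
    ext i j
    simp [Module.Basis.toMatrix_apply, b, hf]
  obtain ⟨v, hv, hvb, hprod⟩ := exists_linearIndependent_prod_norm_le b
  have hint : ∀ m, ∃ a : Fin n → ℤ, v m = f fun i => (a i : ℝ) := by
    intro m
    obtain ⟨c, hc⟩ := (Submodule.mem_span_range_iff_exists_fun ℤ).1 (hvb m)
    refine ⟨c, ?_⟩
    have hcast : (fun i => (c i : ℝ)) = ∑ i, c i • (Pi.basisFun ℝ (Fin n)) i := by
      ext i
      simp [Finset.sum_apply, Pi.single_apply]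
    rw [hcast, map_sum, ← hc]
    exact Finset.sum_congr rfl fun i _ => by rw [map_zsmul]; rfl
  choose a ha using hint
  refine ⟨a, ?_, ?_⟩
  · refine LinearIndependent.of_comp f.toLinearMap ?_
    convert hv using 1
    ext1 m
    exact (ha m).symm
  · have hnorm : ∀ m, ∑ i, (B.mulVec (fun l => (a m l : ℝ)) i) ^ 2 = ‖v m‖ ^ 2 := by
      intro m
      simp [EuclideanSpace.norm_sq_eq, ha, hf]
    rw [Finset.prod_congr rfl fun m _ => hnorm m, Finset.prod_pow]
    rw [hdet] at hprod
    calc (∏ m, ‖v m‖) ^ 2 ≤ (√n ^ n * |B.det|) ^ 2 :=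
          pow_le_pow_left₀ (Finset.prod_nonneg fun _ _ => norm_nonneg _) hprod 2
      _ = (n : ℝ) ^ n * B.det ^ 2 := by
          rw [mul_pow, sq_abs, ← pow_mul, mul_comm n 2, pow_mul, Real.sq_sqrt (by positivity)]

/-- A matrix `B = 1 - c h hᵀ` with `Bᵀ B = 1 - r h hᵀ / (1 + r ‖h‖²)`, with the square of its
determinant. -/
lemma exists_matrix_sum_mulVec_sq {n : ℕ} (r : ℝ) (hr : 0 < r) (h : Fin n → ℝ) :
    ∃ B : Matrix (Fin n) (Fin n) ℝ, B.det ^ 2 = (1 + (∑ i, h i ^ 2) * r)⁻¹ ∧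
      ∀ x : Fin n → ℝ, ∑ i, (B.mulVec x i) ^ 2 =
        ∑ i, x i ^ 2 - r * (∑ i, h i * x i) ^ 2 / (1 + (∑ i, h i ^ 2) * r) := by
  set N := ∑ i, h i ^ 2 with hN
  have hN0 : 0 ≤ N := Finset.sum_nonneg fun i _ => sq_nonneg _
  set s := √(1 + N * r) with hs
  have hs2 : s ^ 2 = 1 + N * r := Real.sq_sqrt (by positivity)
  have hs0 : 0 < s := Real.sqrt_pos.2 (by positivity)
  have hcN : 1 - r / (s * (1 + s)) * N = s⁻¹ := by
    field_simp
    linear_combination hs2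
  set c := r / (s * (1 + s)) with hc
  refine ⟨1 - Matrix.vecMulVec (c • h) h, ?_, fun x => ?_⟩
  · have hdet : (1 - Matrix.vecMulVec (c • h) h).det = 1 - c * N := by
      rw [Matrix.vecMulVec_eq Unit, Matrix.det_one_sub_mul_comm, Matrix.det_unique]
      simp [Matrix.mul_apply, hN, Finset.mul_sum, pow_two, mul_left_comm]
    rw [hdet, hcN, inv_pow, hs2]
  · set p := ∑ i, h i * x i with hp
    have hB : ∀ i, (1 - Matrix.vecMulVec (c • h) h).mulVec x i = x i - c * p * h i := by
      intro i
      rw [Matrix.sub_mulVec, Matrix.one_mulVec, Pi.sub_apply]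
      simp only [Matrix.mulVec, dotProduct, Matrix.vecMulVec_apply, Pi.smul_apply, smul_eq_mul,
        hp, Finset.mul_sum, Finset.sum_mul]
      congr 1
      exact Finset.sum_congr rfl fun _ _ => by ring
    have hexp : ∑ i, (x i - c * p * h i) ^ 2 =
        ∑ i, x i ^ 2 - 2 * c * p * p + (c * p) ^ 2 * N := by
      rw [hp, hN, Finset.mul_sum _ _ (2 * c * _), Finset.mul_sum _ _ (_ ^ 2),
        ← Finset.sum_sub_distrib, ← Finset.sum_add_distrib]
      exact Finset.sum_congr rfl fun _ _ => by ring
    simp only [hB]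
    rw [hexp, ← hs2]
    have hcs : c * (1 + s⁻¹) = r / s ^ 2 := by
      rw [hc]
      field_simp
      ring
    rw [mul_div_right_comm, ← hcs]
    linear_combination (-c * p ^ 2) * hcN

/-- The effective noise variance in closed form. -/
lemma iInf_effective_noise {n : ℕ} (r : ℝ) (hr : 0 < r) (h x : Fin n → ℝ) :
    ⨅ β : ℝ, r * (∑ i, (β * h i - x i) ^ 2) + β ^ 2 =
      r * (∑ i, x i ^ 2 - r * (∑ i, h i * x i) ^ 2 / (1 + (∑ i, h i ^ 2) * r)) := by
  set N := ∑ i, h i ^ 2 with hN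
  set p := ∑ i, h i * x i with hp
  have hN0 : 0 ≤ N := Finset.sum_nonneg fun i _ => sq_nonneg _
  have hD : 0 < 1 + N * r := by positivity
  have hsq : ∀ β : ℝ, r * (∑ i, (β * h i - x i) ^ 2) + β ^ 2 =
      r * (∑ i, x i ^ 2 - r * p ^ 2 / (1 + N * r)) +
        (1 + N * r) * (β - r * p / (1 + N * r)) ^ 2 := by
    intro β
    have hexp : ∑ i, (β * h i - x i) ^ 2 = β ^ 2 * N - 2 * β * p + ∑ i, x i ^ 2 := by
      rw [hp, hN, Finset.mul_sum, Finset.mul_sum,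
        ← Finset.sum_sub_distrib, ← Finset.sum_add_distrib]
      exact Finset.sum_congr rfl fun _ _ => by ring
    rw [hexp]
    field_simp
    ring
  refine IsLeast.csInf_eq ⟨⟨r * p / (1 + N * r), by simp only [hsq]; simp⟩, ?_⟩
  rintro _ ⟨β, rfl⟩
  simp only [hsq]
  exact le_add_of_nonneg_right (by positivity)

/-- For every integer `K ≥ 1`, `SNR > 0`, and `h ∈ ℝ^K`, there exist `K` integer vectors
`a₁, …, a_K ∈ ℤ^K`, linearly independent over `ℝ`, whose computation rates sum to at
least `(1/2)·log₂(1 + ‖h‖²·SNR) − (K/2)·log₂ K`. -/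
theorem stmt2 (K : ℕ) (hK : 1 ≤ K) (SNR : ℝ) (hSNR : 0 < SNR) (h : Fin K → ℝ) :
    ∃ a : Fin K → (Fin K → ℤ),
      LinearIndependent ℝ (fun m => fun i => ((a m i : ℝ))) ∧
      ∑ m, (1 / 2 : ℝ) *
          Real.logb 2 (SNR /
            (⨅ β : ℝ, SNR * (∑ i, (β * h i - (a m i : ℝ)) ^ 2) + β ^ 2))
        ≥ (1 / 2 : ℝ) * Real.logb 2 (1 + (∑ i, (h i) ^ 2) * SNR)
            - ((K : ℝ) / 2) * Real.logb 2 K := by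
  obtain ⟨B, hdet, hB⟩ := exists_matrix_sum_mulVec_sq SNR hSNR h
  set D := 1 + (∑ i, (h i) ^ 2) * SNR with hD
  have hD0 : 0 < D :=
    add_pos_of_pos_of_nonneg one_pos
      (mul_nonneg (Finset.sum_nonneg fun i _ => sq_nonneg _) hSNR.le)
  have hB0 : B.det ≠ 0 := fun h0 => by
    rw [h0, zero_pow two_ne_zero] at hdet
    exact (inv_pos.2 hD0).ne hdet
  obtain ⟨a, ha, hprod⟩ := exists_linearIndependent_int_prod_le B hB0
  refine ⟨a, ha, ?_⟩
  set Q : Fin K → ℝ := fun m => ∑ i, (B.mulVec (fun l => (a m l : ℝ)) i) ^ 2 with hQ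
  have hQpos : ∀ m, 0 < Q m := by
    intro m
    have hne : B.mulVec (fun l => (a m l : ℝ)) ≠ 0 := fun h0 =>
      ha.ne_zero m (Matrix.eq_zero_of_mulVec_eq_zero hB0 h0)
    obtain ⟨i, hi⟩ := Function.ne_iff.1 hne
    exact Finset.sum_pos' (fun _ _ => sq_nonneg _) ⟨i, mem_univ i, sq_pos_of_ne_zero hi⟩
  have hrate : ∀ m, Real.logb 2 (SNR /
      (⨅ β : ℝ, SNR * (∑ i, (β * h i - (a m i : ℝ)) ^ 2) + β ^ 2)) = -Real.logb 2 (Q m) := by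
    intro m
    rw [iInf_effective_noise SNR hSNR h, ← hD, ← hB, div_mul_cancel_left₀ hSNR.ne',
      Real.logb_inv]
  have hK0 : (0 : ℝ) < K := by exact_mod_cast hK
  have hlog : ∑ m, Real.logb 2 (Q m) ≤ K * Real.logb 2 K - Real.logb 2 D := by
    rw [← Real.logb_prod _ _ fun m _ => (hQpos m).ne', ← Real.logb_pow, sub_eq_add_neg,
      ← Real.logb_inv, ← Real.logb_mul (by positivity) (by positivity), ← hdet]
    exact Real.logb_le_logb_of_le one_lt_two (Finset.prod_pos fun m _ => hQpos m) hprod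
  simp only [hrate, ← Finset.mul_sum, Finset.sum_neg_distrib]
  linarith
end

section
/- Let K ≥ 2 be an integer, let SNR ≥ 1 be real, and let g ∈ ℝ satisfy g² ≥ SNR. Define σ²(a₁, a₂) := inf_{β ∈ ℝ} (SNR·((β − a₁)² + (K−1)·(β·g − a₂)²) + β²). Then there exist two vectors (a₁, a₂) and (a₁′, a₂′) in ℤ², linearly independent over ℝ, such that σ²(a₁, a₂) ≤ 4·SNR/(1 + SNR) and σ²(a₁′, a₂′) ≤ 4·SNR/(1 + SNR). Equivalently, in the very strong interference regime the second-highest computation rate of the effective two-user multiple-access channel with channel vector (1, g) and weights (1, K−1) is at least (1/2)·log₂(1 + SNR) − 1. -/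
/-- Evaluating at `β = a₂ / g`, which cancels the interference term, bounds the infimum. -/
theorem iInf_noise_le_zero_forcing {c S g : ℝ} (hc : 0 ≤ c) (hS : 0 ≤ S) (hg : g ≠ 0)
    (x y : ℝ) :
    (⨅ β : ℝ, S * ((β - x) ^ 2 + c * (β * g - y) ^ 2) + β ^ 2)
      ≤ S * (y / g - x) ^ 2 + (y / g) ^ 2 := by
  have hbdd : BddBelow (Set.range fun β : ℝ =>
      S * ((β - x) ^ 2 + c * (β * g - y) ^ 2) + β ^ 2) := by
    refine ⟨0, ?_⟩
    rintro _ ⟨β, rfl⟩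
    positivity
  refine (ciInf_le hbdd (y / g)).trans_eq ?_
  simp [div_mul_cancel₀ y hg]

/-- Very strong interference regime: for `K ≥ 2`, `SNR ≥ 1` and `g² ≥ SNR`, there are two
linearly independent integer coefficient pairs whose effective noise variances
`σ²(a₁,a₂) = inf_β SNR·((β − a₁)² + (K−1)·(β·g − a₂)²) + β²` are both at most
`4·SNR/(1 + SNR)`; equivalently the second-highest computation rate is at least
`(1/2)·log₂(1 + SNR) − 1`. -/
theorem stmt4 (K : ℕ) (hK : 2 ≤ K) (SNR g : ℝ) (hSNR : 1 ≤ SNR) (hg : SNR ≤ g ^ 2) :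
    ∃ a₁ a₂ a₁' a₂' : ℤ, a₁ * a₂' - a₂ * a₁' ≠ 0 ∧
      (⨅ β : ℝ, SNR * ((β - (a₁ : ℝ)) ^ 2 + ((K : ℝ) - 1) * (β * g - (a₂ : ℝ)) ^ 2) + β ^ 2)
          ≤ 4 * SNR / (1 + SNR) ∧
      (⨅ β : ℝ, SNR * ((β - (a₁' : ℝ)) ^ 2 + ((K : ℝ) - 1) * (β * g - (a₂' : ℝ)) ^ 2) + β ^ 2)
          ≤ 4 * SNR / (1 + SNR) := by
  have hS : 0 < SNR := by linarith
  have hg0 : g ≠ 0 := by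
    rintro rfl
    norm_num at hg
    linarith
  have hc : (0 : ℝ) ≤ (K : ℝ) - 1 := by
    have : (2 : ℝ) ≤ K := by exact_mod_cast hK
    linarith
  have hbound := iInf_noise_le_zero_forcing hc hS.le hg0
  have hg2 : (1 / g) ^ 2 ≤ 1 / SNR := by
    rw [div_pow, one_pow]
    exact one_div_le_one_div_of_le hS hg
  set t : ℝ := SNR / (1 + SNR) with ht
  refine ⟨0, 1, 1, round (g * t), by simp, (hbound _ _).trans ?_, (hbound _ _).trans ?_⟩
  · calc SNR * (((1 : ℤ) : ℝ) / g - ((0 : ℤ) : ℝ)) ^ 2 + (((1 : ℤ) : ℝ) / g) ^ 2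
        = (1 + SNR) * (1 / g) ^ 2 := by push_cast; ring
      _ ≤ (1 + SNR) * (1 / SNR) := by gcongr
      _ ≤ 4 * SNR / (1 + SNR) := by
        rw [mul_one_div, div_le_div_iff₀ hS (by positivity)]
        nlinarith
  · set r : ℝ := (round (g * t) : ℝ)
    have hr : (r - g * t) ^ 2 ≤ (1 / 2) ^ 2 := by
      rw [sq_le_sq, abs_sub_comm, abs_of_nonneg (show (0 : ℝ) ≤ 1 / 2 by norm_num)]
      exact abs_sub_round _
    have hdist : (r / g - t) ^ 2 ≤ 1 / 4 * (1 / SNR) := by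
      calc (r / g - t) ^ 2 = (r - g * t) ^ 2 * (1 / g) ^ 2 := by field_simp
        _ ≤ (1 / 2) ^ 2 * (1 / SNR) := by gcongr
        _ = 1 / 4 * (1 / SNR) := by norm_num
    calc SNR * (r / g - ((1 : ℤ) : ℝ)) ^ 2 + (r / g) ^ 2
        = (1 + SNR) * (r / g - t) ^ 2 + t := by
          generalize r / g = q
          rw [ht]
          push_cast
          field_simp
          ring
      _ ≤ (1 + SNR) * (1 / 4 * (1 / SNR)) + t := by gcongr
      _ ≤ 4 * SNR / (1 + SNR) := by
        have h3 : (1 + SNR) * (1 / 4 * (1 / SNR)) ≤ 3 * SNR / (1 + SNR) := by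
          rw [← mul_assoc, mul_one_div, div_le_div_iff₀ hS (by positivity)]
          nlinarith
        have h4 : 4 * SNR / (1 + SNR) = 3 * SNR / (1 + SNR) + t := by
          rw [ht]
          ring
        linarith
end

section
/- Let SNR > 1 and c > 0 be reals, set δ := (c+1)/log₂(SNR), let b ≥ 1 be an integer, and define q_max := SNR^{1/4 − δ/2}/√(b + 1/2), Φ := √(b + 1/2)·SNR^{−1/4 − δ/2}, and S_b := { g ∈ [b, b+1) : there exist integers q and a with 0 < q ≤ q_max and |q·g − a| < Φ }. Then: (i) the Lebesgue measure of S_b is at most 2^{−c}; (ii) for every g ∈ [b, b+1) ∖ S_b with g² < SNR, the infimum over β ∈ ℝ and over integer pairs (a₁, a₂) ≠ (0, 0) of ((β − a₁)² + (β·g − a₂)²)·SNR + β² is at least 2^{−c}·√SNR/(16·g). -/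
open MeasureTheory

/-- The points of `[b, b+1)` at which `q * g` is within `Φ` of an integer have measure at most
`2 * Φ`. -/
theorem volume_setOf_near_int_le (b : ℤ) (n : ℕ) (hn : 0 < n) {Φ : ℝ} (hΦ : 0 ≤ Φ) :
    volume {g : ℝ | g ∈ Set.Ico (b : ℝ) ((b : ℝ) + 1) ∧ ∃ a : ℤ, |(n : ℝ) * g - (a : ℝ)| < Φ}
      ≤ ENNReal.ofReal (2 * Φ) := by
  have hn' : (0 : ℝ) < n := by exact_mod_cast hn
  have hsub : {g : ℝ | g ∈ Set.Ico (b : ℝ) ((b : ℝ) + 1) ∧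
      ∃ a : ℤ, |(n : ℝ) * g - (a : ℝ)| < Φ} ⊆
      ⋃ j ∈ Finset.range n,
        (Set.Ico ((n * b + j) / n : ℝ) ((n * b + j + Φ) / n) ∪
          Set.Ioo ((n * b + j + 1 - Φ) / n : ℝ) ((n * b + j + 1) / n)) := by
    rintro g ⟨⟨hg1, hg2⟩, a, ha⟩
    rw [abs_lt] at ha
    have hk1 := Int.floor_le ((n : ℝ) * g)
    have hk2 := Int.lt_floor_add_one ((n : ℝ) * g)
    have hlow : (n : ℤ) * b ≤ ⌊(n : ℝ) * g⌋ := by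
      rw [Int.le_floor]
      push_cast
      exact mul_le_mul_of_nonneg_left hg1 hn'.le
    have hupp : ⌊(n : ℝ) * g⌋ < (n : ℤ) * b + n := by
      rw [Int.floor_lt]
      push_cast
      nlinarith
    generalize ⌊(n : ℝ) * g⌋ = k at *
    obtain ⟨j, hj⟩ := Int.eq_ofNat_of_zero_le (sub_nonneg.2 hlow)
    have hkj : (k : ℝ) = n * b + j := by
      have : k = n * b + j := by linarith
      rw [this]
      push_cast
      ring
    simp only [Set.mem_iUnion, Finset.mem_range]
    refine ⟨j, by omega, ?_⟩
    rcases le_or_gt a k with hak | hak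
    · left
      have : (a : ℝ) ≤ k := by exact_mod_cast hak
      constructor
      · rw [div_le_iff₀ hn']
        linarith
      · rw [lt_div_iff₀ hn']
        linarith
    · right
      have : (k : ℝ) + 1 ≤ a := by exact_mod_cast hak
      constructor
      · rw [div_lt_iff₀ hn']
        linarith
      · rw [lt_div_iff₀ hn']
        linarith
  calc _ ≤ _ := measure_mono hsub
    _ ≤ ∑ j ∈ Finset.range n, ENNReal.ofReal (2 * Φ / n) := by
      refine (measure_biUnion_finset_le _ _).trans (Finset.sum_le_sum fun j _ => ?_)
      refine (measure_union_le _ _).trans ?_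
      rw [Real.volume_Ico, Real.volume_Ioo,
        ← ENNReal.ofReal_add (by rw [← sub_div]; apply div_nonneg <;> linarith)
          (by rw [← sub_div]; apply div_nonneg <;> linarith)]
      apply ENNReal.ofReal_le_ofReal
      apply le_of_eq
      ring
    _ = ENNReal.ofReal (2 * Φ) := by
      rw [Finset.sum_const, Finset.card_range, nsmul_eq_mul, ← ENNReal.ofReal_natCast,
        ← ENNReal.ofReal_mul hn'.le]
      congr 1
      field_simp

/-- The points of `[b, b+1)` having a rational approximation of quality `Φ` with denominator at
most `Q` have measure at most `2 * Φ * Q`. -/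
theorem volume_setOf_approx_le (b : ℤ) {Q Φ : ℝ} (hQ : 0 ≤ Q) (hΦ : 0 ≤ Φ) :
    volume {g : ℝ | g ∈ Set.Ico (b : ℝ) ((b : ℝ) + 1) ∧
      ∃ q a : ℤ, 0 < q ∧ (q : ℝ) ≤ Q ∧ |(q : ℝ) * g - (a : ℝ)| < Φ}
      ≤ ENNReal.ofReal (2 * Φ * Q) := by
  have hsub : {g : ℝ | g ∈ Set.Ico (b : ℝ) ((b : ℝ) + 1) ∧
      ∃ q a : ℤ, 0 < q ∧ (q : ℝ) ≤ Q ∧ |(q : ℝ) * g - (a : ℝ)| < Φ} ⊆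
      ⋃ n ∈ Finset.Icc 1 ⌊Q⌋₊, {g : ℝ | g ∈ Set.Ico (b : ℝ) ((b : ℝ) + 1) ∧
        ∃ a : ℤ, |(n : ℝ) * g - (a : ℝ)| < Φ} := by
    rintro g ⟨hg, q, a, hq, hqQ, ha⟩
    lift q to ℕ using hq.le
    rw [Int.cast_natCast] at hqQ ha
    simp only [Set.mem_iUnion, Finset.mem_Icc]
    exact ⟨q, ⟨by omega, Nat.le_floor hqQ⟩, hg, a, ha⟩
  calc _ ≤ _ := measure_mono hsub
    _ ≤ ∑ n ∈ Finset.Icc 1 ⌊Q⌋₊, ENNReal.ofReal (2 * Φ) := by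
      refine (measure_biUnion_finset_le _ _).trans (Finset.sum_le_sum fun n hn => ?_)
      exact volume_setOf_near_int_le b n (Finset.mem_Icc.1 hn).1 hΦ
    _ = ENNReal.ofReal (⌊Q⌋₊ * (2 * Φ)) := by
      rw [Finset.sum_const, Nat.card_Icc, nsmul_eq_mul, Nat.add_sub_cancel,
        ← ENNReal.ofReal_natCast, ← ENNReal.ofReal_mul (Nat.cast_nonneg _)]
    _ ≤ ENNReal.ofReal (2 * Φ * Q) := by
      apply ENNReal.ofReal_le_ofReal
      nlinarith [Nat.floor_le hQ]

/-- If `|u * g - v|` is bounded below by `D`, every multiple of `(1, g)` stays at squared distance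
at least `D ^ 2 / (2 * g ^ 2)` from `(u, v)`. -/
theorem sq_div_le_sq_add_sq {g D β u v : ℝ} (hg : 1 ≤ g) (hD : 0 ≤ D) (h : D ≤ |u * g - v|) :
    D ^ 2 / (2 * g ^ 2) ≤ (β - u) ^ 2 + (β * g - v) ^ 2 := by
  have h1 : D ^ 2 ≤ (u * g - v) ^ 2 := by
    rw [← sq_abs (u * g - v)]
    gcongr
  have h2 : (u * g - v) ^ 2 ≤ ((β - u) ^ 2 + (β * g - v) ^ 2) * (1 + g ^ 2) := by
    nlinarith [sq_nonneg ((β - u) + g * (β * g - v))]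
  rw [div_le_iff₀ (by positivity)]
  have h3 : 1 + g ^ 2 ≤ 2 * g ^ 2 := by nlinarith
  have h4 : 0 ≤ (β - u) ^ 2 + (β * g - v) ^ 2 := by positivity
  nlinarith [mul_le_mul_of_nonneg_left h3 h4]

/-- The effective noise variance is bounded below when `g` has no good rational approximation;
here `s ^ 4` is the signal-to-noise ratio, `B ^ 2` is the midpoint of `[b, b+1)`, and `T ^ 2`
controls the measure of the outage set. -/
theorem effective_noise_ge {s T B g β : ℝ} {a₁ a₂ : ℤ} (hs : 1 ≤ s) (hT : 0 < T)
    (hT1 : T ≤ 1) (hB : 0 < B) (hg : 1 ≤ g) (hB1 : B ^ 2 ≤ 3 / 2 * g) (hB2 : g / 2 ≤ B ^ 2)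
    (hgs : g ≤ s ^ 2) (ha : ¬(a₁ = 0 ∧ a₂ = 0))
    (hS : ∀ q a : ℤ, 0 < q → (q : ℝ) ≤ s * T / B → B * T / s ≤ |(q : ℝ) * g - a|) :
    T ^ 2 * s ^ 2 / (8 * g) ≤
      ((β - (a₁ : ℝ)) ^ 2 + (β * g - (a₂ : ℝ)) ^ 2) * s ^ 4 + β ^ 2 := by
  have hs0 : 0 < s := by linarith
  have hg0 : 0 < g := by linarith
  by_cases h0 : a₁ = 0
  · have ha2 : a₂ ≠ 0 := fun h => ha ⟨h0, h⟩
    have h1 : (1 : ℝ) ≤ |(a₁ : ℝ) * g - a₂| := by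
      rw [h0, Int.cast_zero, zero_mul, zero_sub, abs_neg]
      exact_mod_cast Int.one_le_abs ha2
    have h2 := sq_div_le_sq_add_sq (β := β) hg zero_le_one h1
    have h3 : T ^ 2 * s ^ 2 / (8 * g) ≤ 1 ^ 2 / (2 * g ^ 2) * s ^ 4 := by
      rw [one_pow, div_mul_eq_mul_div, one_mul, div_le_div_iff₀ (by positivity) (by positivity)]
      calc T ^ 2 * s ^ 2 * (2 * g ^ 2) ≤ 1 ^ 2 * s ^ 2 * (2 * (g * s ^ 2)) := by
            rw [pow_two g]
            gcongr
        _ ≤ s ^ 4 * (8 * g) := by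
            have : 0 ≤ s ^ 4 * g := by positivity
            nlinarith
    calc _ ≤ _ := h3
      _ ≤ ((β - (a₁ : ℝ)) ^ 2 + (β * g - (a₂ : ℝ)) ^ 2) * s ^ 4 := by gcongr
      _ ≤ _ := le_add_of_nonneg_right (sq_nonneg _)
  by_cases hq : |(a₁ : ℝ)| ≤ s * T / B
  · have h1 : B * T / s ≤ |(a₁ : ℝ) * g - a₂| := by
      rcases lt_or_gt_of_ne h0 with h | h
      · have hneg : (a₁ : ℝ) < 0 := by exact_mod_cast h
        rw [abs_of_neg hneg] at hq
        have := hS (-a₁) (-a₂) (by omega) (by push_cast; exact hq)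
        rw [← abs_neg]
        convert this using 2
        push_cast
        ring
      · have hpos : (0 : ℝ) < a₁ := by exact_mod_cast h
        rw [abs_of_pos hpos] at hq
        exact hS a₁ a₂ h hq
    have h2 := sq_div_le_sq_add_sq (β := β) hg (by positivity) h1
    have h3 : T ^ 2 * s ^ 2 / (8 * g) ≤ (B * T / s) ^ 2 / (2 * g ^ 2) * s ^ 4 := by
      have e : (B * T / s) ^ 2 / (2 * g ^ 2) * s ^ 4 = B ^ 2 * (T ^ 2 * s ^ 2 / (2 * g ^ 2)) := by
        field_simp
      rw [e]
      calc T ^ 2 * s ^ 2 / (8 * g) ≤ T ^ 2 * s ^ 2 / (4 * g) := by gcongr; norm_num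
        _ = g / 2 * (T ^ 2 * s ^ 2 / (2 * g ^ 2)) := by field_simp; norm_num
        _ ≤ _ := by gcongr
    calc _ ≤ _ := h3
      _ ≤ ((β - (a₁ : ℝ)) ^ 2 + (β * g - (a₂ : ℝ)) ^ 2) * s ^ 4 := by gcongr
      _ ≤ _ := le_add_of_nonneg_right (sq_nonneg _)
  · push Not at hq
    have h1 : (s * T / B) ^ 2 ≤ (a₁ : ℝ) ^ 2 := by
      rw [← sq_abs (a₁ : ℝ)]
      gcongr
    have h2 : (a₁ : ℝ) ^ 2 / 2 ≤ (β - a₁) ^ 2 + β ^ 2 := by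
      nlinarith [sq_nonneg (2 * β - a₁)]
    have h3 : T ^ 2 * s ^ 2 / (8 * g) ≤ (s * T / B) ^ 2 / 2 := by
      rw [div_pow, div_div, mul_pow, mul_comm (s ^ 2)]
      exact div_le_div_of_nonneg_left (by positivity) (by positivity) (by linarith)
    have h4 : (β - (a₁ : ℝ)) ^ 2 * 1 ≤
        ((β - (a₁ : ℝ)) ^ 2 + (β * g - (a₂ : ℝ)) ^ 2) * s ^ 4 := by
      gcongr
      · exact le_add_of_nonneg_right (sq_nonneg _)
      · exact one_le_pow₀ hs
    linarith

/-- Strong interference regime: with `δ = (c+1)/log₂ SNR`,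
`q_max = SNR^{1/4−δ/2}/√(b+1/2)` and `Φ = √(b+1/2)·SNR^{−1/4−δ/2}`, the outage set
`S_b = {g ∈ [b,b+1) : ∃ q,a ∈ ℤ, 0 < q ≤ q_max, |q·g − a| < Φ}` has Lebesgue measure
at most `2^{−c}`, and for every `g ∈ [b,b+1) ∖ S_b` with `g² < SNR`, the infimum over
`β` and nonzero integer pairs `(a₁,a₂)` of `((β−a₁)² + (β·g−a₂)²)·SNR + β²` is at least
`2^{−c}·√SNR/(16·g)`. -/
theorem stmt5 (SNR c : ℝ) (hSNR : 1 < SNR) (hc : 0 < c) (b : ℤ) (hb : 1 ≤ b) :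
    let δ : ℝ := (c + 1) / Real.logb 2 SNR
    let qmax : ℝ := SNR ^ (1 / 4 - δ / 2 : ℝ) / Real.sqrt ((b : ℝ) + 1 / 2)
    let Φ : ℝ := Real.sqrt ((b : ℝ) + 1 / 2) * SNR ^ (-(1 / 4) - δ / 2 : ℝ)
    let S : Set ℝ := {g | g ∈ Set.Ico (b : ℝ) ((b : ℝ) + 1) ∧
      ∃ q a : ℤ, 0 < q ∧ (q : ℝ) ≤ qmax ∧ |(q : ℝ) * g - (a : ℝ)| < Φ}
    volume S ≤ ENNReal.ofReal ((2 : ℝ) ^ (-c : ℝ)) ∧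
    ∀ g ∈ Set.Ico (b : ℝ) ((b : ℝ) + 1) \ S, g ^ 2 < SNR →
      ∀ (β : ℝ) (a₁ a₂ : ℤ), ¬(a₁ = 0 ∧ a₂ = 0) →
        ((β - (a₁ : ℝ)) ^ 2 + (β * g - (a₂ : ℝ)) ^ 2) * SNR + β ^ 2
          ≥ (2 : ℝ) ^ (-c : ℝ) * Real.sqrt SNR / (16 * g) := by
  intro δ qmax Φ S
  have hSNR0 : 0 < SNR := by linarith
  have hb' : (1 : ℝ) ≤ b := by exact_mod_cast hb
  set s : ℝ := SNR ^ (1 / 4 : ℝ) with hs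
  set T : ℝ := (2 : ℝ) ^ (-(c + 1) / 2) with hT
  set B : ℝ := Real.sqrt ((b : ℝ) + 1 / 2) with hB
  have hs1 : 1 ≤ s := Real.one_le_rpow hSNR.le (by norm_num)
  have hs0 : 0 < s := by linarith
  have hT0 : 0 < T := by positivity
  have hT1 : T ≤ 1 := Real.rpow_le_one_of_one_le_of_nonpos (by norm_num) (by linarith)
  have hB0 : 0 < B := Real.sqrt_pos.2 (by linarith)
  have hBsq : B ^ 2 = b + 1 / 2 := Real.sq_sqrt (by linarith)
  have hs4 : s ^ 4 = SNR := by
    rw [hs, ← Real.rpow_natCast, ← Real.rpow_mul hSNR0.le]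
    norm_num
  have hs2 : Real.sqrt SNR = s ^ 2 := by
    rw [← hs4, show s ^ 4 = (s ^ 2) ^ 2 by ring]
    exact Real.sqrt_sq (by positivity)
  have hT2 : (2 : ℝ) ^ (-c) = 2 * T ^ 2 := by
    rw [hT, ← Real.rpow_natCast, ← Real.rpow_mul (by norm_num)]
    nth_rewrite 2 [← Real.rpow_one 2]
    rw [← Real.rpow_add (by norm_num)]
    congr 1
    push_cast
    ring
  have hδ : SNR ^ (-(δ / 2)) = T := by
    have hlog : Real.logb 2 SNR ≠ 0 := (Real.logb_pos (by norm_num) hSNR).ne'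
    have h2 : SNR = (2 : ℝ) ^ Real.logb 2 SNR :=
      (Real.rpow_logb (by norm_num) (by norm_num) hSNR0).symm
    calc SNR ^ (-(δ / 2)) = ((2 : ℝ) ^ Real.logb 2 SNR) ^ (-(δ / 2)) := by rw [← h2]
      _ = T := by
        rw [← Real.rpow_mul (by norm_num), hT]
        congr 1
        simp only [δ]
        field_simp
  have hqmax : qmax = s * T / B := by
    simp only [qmax]
    rw [sub_eq_add_neg, Real.rpow_add hSNR0, hδ]
  have hΦ : Φ = B * T / s := by
    simp only [Φ]
    rw [sub_eq_add_neg, Real.rpow_add hSNR0, hδ, Real.rpow_neg hSNR0.le, ← hs, ← hB]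
    ring
  constructor
  · have h := volume_setOf_approx_le b (Q := qmax) (Φ := Φ) (by rw [hqmax]; positivity)
      (by rw [hΦ]; positivity)
    convert h using 2
    rw [hT2, hqmax, hΦ]
    field_simp
  · rintro g ⟨hg, hgS⟩ hgSNR β a₁ a₂ ha
    have hg1 : 1 ≤ g := hb'.trans hg.1
    have hg2 := hg.2
    have hgs : g ≤ s ^ 2 := by
      rw [← hs2]
      exact Real.le_sqrt_of_sq_le hgSNR.le
    have key := effective_noise_ge (β := β) hs1 hT0 hT1 hB0 hg1 (by linarith [hg.1])
      (by linarith) hgs ha (fun q a hq hqm => by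
        rw [← hΦ]
        by_contra! hlt
        exact hgS ⟨hg, q, a, hq, hqmax ▸ hqm, hlt⟩)
    rw [hs4] at key
    rw [hT2, hs2, ge_iff_le]
    refine le_of_eq_of_le ?_ key
    field_simp
    norm_num
end

section
/- Let K ≥ 2 be an integer, let SNR > 4 be real, and let g > 0 satisfy SNR^{−1/2} ≤ g² < SNR^{−1/3}. Then the infimum over β ∈ ℝ and over integer triples (a₁, a₂, a₃) ≠ (0, 0, 0) of K·β² + ((β − a₁)² + (β/√(g²·SNR − 1) − a₂)² + (K−1)·(β·g − a₃)²)·SNR is at least g²·SNR/4. (Note g²·SNR − 1 > 0 under the stated hypotheses.) -/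
/-- A real number of absolute value at most `1 - c` is at distance at least `c` from every nonzero
integer. -/
lemma sq_sub_intCast_ge_of_abs_le {x c : ℝ} {a : ℤ} (ha : a ≠ 0) (hc : 0 ≤ c)
    (hx : |x| ≤ 1 - c) : c ^ 2 ≤ (x - a) ^ 2 := by
  have h1 : (1 : ℝ) ≤ |(a : ℝ)| := by exact_mod_cast Int.one_le_abs ha
  have h2 : |(a : ℝ)| - |x| ≤ |x - a| := by
    rw [abs_sub_comm]
    exact abs_sub_abs_le_abs_sub _ _
  rw [← sq_abs (x - a)]
  exact pow_le_pow_left₀ hc (by linarith) 2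

/-- Weak interference regime: for `K ≥ 2`, `SNR > 4` and `g > 0` with
`SNR^{−1/2} ≤ g² < SNR^{−1/3}`, the effective Han–Kobayashi noise variance
`K·β² + ((β − a₁)² + (β/√(g²·SNR − 1) − a₂)² + (K−1)·(β·g − a₃)²)·SNR`
is at least `g²·SNR/4` for all `β ∈ ℝ` and nonzero integer triples `(a₁,a₂,a₃)`. -/
theorem stmt7 (K : ℕ) (hK : 2 ≤ K) (SNR g : ℝ) (hSNR : 4 < SNR) (hg : 0 < g)
    (hg1 : SNR ^ (-(1 : ℝ) / 2) ≤ g ^ 2) (hg2 : g ^ 2 < SNR ^ (-(1 : ℝ) / 3)) :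
    ∀ (β : ℝ) (a₁ a₂ a₃ : ℤ), ¬(a₁ = 0 ∧ a₂ = 0 ∧ a₃ = 0) →
      (K : ℝ) * β ^ 2 +
          ((β - (a₁ : ℝ)) ^ 2 + (β / Real.sqrt (g ^ 2 * SNR - 1) - (a₂ : ℝ)) ^ 2 +
            ((K : ℝ) - 1) * (β * g - (a₃ : ℝ)) ^ 2) * SNR
        ≥ g ^ 2 * SNR / 4 := by
  intro β a₁ a₂ a₃ hne
  have hS : 0 < SNR := by linarith
  have hK' : (2 : ℝ) ≤ K := by exact_mod_cast hK
  have hlow : 1 ≤ (g ^ 2) ^ 2 * SNR := by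
    have h : (SNR ^ (-(1 : ℝ) / 2)) ^ 2 * SNR = 1 := by
      rw [← Real.rpow_natCast, ← Real.rpow_mul hS.le]
      norm_num [Real.rpow_neg_one, hS.ne']
    have := pow_le_pow_left₀ (Real.rpow_nonneg hS.le (-(1 : ℝ) / 2)) hg1 2
    nlinarith
  have hhigh : (g ^ 2) ^ 3 * SNR ≤ 1 := by
    have h : (SNR ^ (-(1 : ℝ) / 3)) ^ 3 * SNR = 1 := by
      rw [← Real.rpow_natCast, ← Real.rpow_mul hS.le]
      norm_num [Real.rpow_neg_one, hS.ne']
    have := pow_le_pow_left₀ (sq_nonneg g) hg2.le 3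
    nlinarith
  have hg2' : 0 < g ^ 2 := by positivity
  have hg_sq_le : g ^ 2 ≤ 1 := by
    by_contra! h
    nlinarith [one_lt_pow₀ h (n := 3) (by norm_num)]
  have hg_le : g ≤ 1 := by nlinarith
  have ht : 2 < g ^ 2 * SNR := by
    have : 2 ^ 2 < (g ^ 2 * SNR) ^ 2 := by nlinarith
    exact lt_of_pow_lt_pow_left₀ 2 (by positivity) this
  set s := Real.sqrt (g ^ 2 * SNR - 1)
  have hs_sq : s ^ 2 = g ^ 2 * SNR - 1 := Real.sq_sqrt (by linarith)
  have hβ : 2 * β ^ 2 ≤ K * β ^ 2 := by gcongr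
  have h3 : (β * g - a₃) ^ 2 * SNR ≤ ((K : ℝ) - 1) * (β * g - a₃) ^ 2 * SNR := by
    gcongr
    exact le_mul_of_one_le_left (sq_nonneg _) (by linarith)
  have n0 : 0 ≤ β ^ 2 := sq_nonneg β
  have n1 : 0 ≤ (β - a₁) ^ 2 * SNR := by positivity
  have n2 : 0 ≤ (β / s - a₂) ^ 2 * SNR := by positivity
  have n3 : 0 ≤ (β * g - a₃) ^ 2 * SNR := by positivity
  have hle : g ^ 2 * SNR ≤ SNR := mul_le_of_le_one_left hS.le hg_sq_le
  rw [ge_iff_le, add_mul, add_mul]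
  by_cases ha₂ : a₂ = 0
  · have hterm : β ^ 2 ≤ g ^ 2 * ((β / s - a₂) ^ 2 * SNR) := by
      rw [ha₂, Int.cast_zero, sub_zero, div_pow, hs_sq, div_mul_eq_mul_div, mul_div_assoc',
        le_div_iff₀ (by linarith)]
      nlinarith
    by_cases ha₃ : a₃ = 0
    · have ha₁ : a₁ ≠ 0 := fun h => hne ⟨h, ha₂, ha₃⟩
      rcases le_total |β| (1 - 1 / 2) with h | h
      · have := sq_sub_intCast_ge_of_abs_le ha₁ (by norm_num) h
        nlinarith
      · have hb : 1 / 4 ≤ β ^ 2 := by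
          rw [← sq_abs]
          linarith [pow_le_pow_left₀ (by norm_num) h 2]
        have : (β * g - a₃) ^ 2 * SNR = β ^ 2 * (g ^ 2 * SNR) := by
          rw [ha₃, Int.cast_zero]
          ring
        linarith [mul_le_mul_of_nonneg_right hb (by linarith : 0 ≤ g ^ 2 * SNR)]
    · rcases le_total |β * g| (1 - g / 2) with h | h
      · have := sq_sub_intCast_ge_of_abs_le ha₃ (by linarith) h
        nlinarith
      · have hb : 1 / 4 ≤ β ^ 2 * g ^ 2 := by
          rw [← mul_pow, ← sq_abs]
          linarith [pow_le_pow_left₀ (by norm_num) (by linarith : 1 / 2 ≤ |β * g|) 2]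
        have : (g ^ 2) ^ 2 * (g ^ 2 * SNR / 4) ≤
            (g ^ 2) ^ 2 * ((β / s - a₂) ^ 2 * SNR) := by
          linarith [mul_le_mul_of_nonneg_left hterm hg2'.le]
        have := le_of_mul_le_mul_left this (by positivity)
        linarith
  · rcases le_total (g ^ 2 * SNR / 8) (β ^ 2) with h | h
    · linarith
    · have hd : |β / s| ≤ 1 - 1 / 2 := by
        apply abs_le_of_sq_le_sq _ (by norm_num)
        rw [div_pow, hs_sq, div_le_iff₀ (by linarith)]
        linarith
      have := mul_le_mul_of_nonneg_right
        (sq_sub_intCast_ge_of_abs_le ha₂ (by norm_num) hd) hS.le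
      linarith
end

section
/- For every real SNR > 4 and every real c > 0, there exists a Lebesgue-measurable set S ⊆ (0, 1) with measure at most 2^{−c} such that for every integer K ≥ 2 and every g ∈ (0, 1) ∖ S with g² ≥ SNR^{−1/3}, the infimum over β ∈ ℝ and over integer triples (a₁, a₂, a₃) ≠ (0, 0, 0) of K·β² + ((β − a₁)² + (β/√(g²·SNR − 1) − a₂)² + (K−1)·(β·g − a₃)²)·SNR is at least 2^{−2c}·2^{−10}·√SNR/g. -/
open MeasureTheory

/-- The points of `ℝ` lying within `δ / q` of a fraction `p / q` with `0 ≤ p ≤ q` and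
`1 ≤ q ≤ N`. -/
def nearFractions (N : ℕ) (δ : ℝ) : Set ℝ :=
  ⋃ q ∈ Finset.Icc 1 N, ⋃ p ∈ Finset.range (q + 1),
    Set.Icc (((p : ℝ) - δ) / q) (((p : ℝ) + δ) / q)

lemma measurableSet_nearFractions (N : ℕ) (δ : ℝ) : MeasurableSet (nearFractions N δ) :=
  Finset.measurableSet_biUnion _ fun _ _ =>
    Finset.measurableSet_biUnion _ fun _ _ => measurableSet_Icc

lemma volume_nearFractions_le (N : ℕ) {δ : ℝ} (hδ : 0 ≤ δ) :
    volume (nearFractions N δ) ≤ ENNReal.ofReal (4 * (N * δ)) := by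
  have hq : ∀ q ∈ Finset.Icc 1 N,
      volume (⋃ p ∈ Finset.range (q + 1), Set.Icc (((p : ℝ) - δ) / q) (((p : ℝ) + δ) / q))
        ≤ ENNReal.ofReal (4 * δ) := by
    intro q hq
    have hq1 : (1 : ℝ) ≤ q := by exact_mod_cast (Finset.mem_Icc.1 hq).1
    refine (measure_biUnion_finset_le _ _).trans ?_
    have hp : ∀ p : ℕ, volume (Set.Icc (((p : ℝ) - δ) / q) (((p : ℝ) + δ) / q))
        = ENNReal.ofReal (2 * δ / q) := by
      intro p
      rw [Real.volume_Icc]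
      congr 1
      ring
    simp only [hp, Finset.sum_const, Finset.card_range, nsmul_eq_mul]
    rw [← ENNReal.ofReal_natCast, ← ENNReal.ofReal_mul (by positivity)]
    apply ENNReal.ofReal_le_ofReal
    rw [mul_div_assoc', div_le_iff₀ (by linarith)]
    push_cast
    nlinarith
  refine (measure_biUnion_finset_le _ _).trans ((Finset.sum_le_sum hq).trans ?_)
  simp only [Finset.sum_const, Nat.card_Icc, nsmul_eq_mul, add_tsub_cancel_right]
  rw [← ENNReal.ofReal_natCast, ← ENNReal.ofReal_mul (by positivity)]
  apply ENNReal.ofReal_le_ofReal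
  linarith

lemma mem_nearFractions {N : ℕ} {δ g : ℝ} (hδ : δ < 1) (hg0 : 0 < g) (hg1 : g < 1) {q p : ℤ}
    (hq : 0 < q) (hqN : q ≤ N) (h : |g * q - p| ≤ δ) : g ∈ nearFractions N δ := by
  have hq' : (0 : ℝ) < q := by exact_mod_cast hq
  obtain ⟨h1, h2⟩ := abs_le.1 h
  have hp0 : 0 ≤ p := by
    have : (-1 : ℝ) < p := by nlinarith [mul_pos hg0 hq']
    have : -1 < p := by exact_mod_cast this
    omega
  have hpq : p ≤ q := by
    have : (p : ℝ) < q + 1 := by nlinarith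
    have : p < q + 1 := by exact_mod_cast this
    omega
  lift q to ℕ using hq.le
  lift p to ℕ using hp0
  simp only [nearFractions, Set.mem_iUnion, exists_prop, Finset.mem_Icc, Finset.mem_range]
  push_cast at *
  refine ⟨q, ⟨by omega, by omega⟩, p, by omega, ?_, ?_⟩
  · rw [div_le_iff₀ hq']; linarith
  · rw [le_div_iff₀ hq']; linarith

lemma mem_nearFractions_of_ne_zero {N : ℕ} {δ g : ℝ} (hδ : δ < 1) (hg0 : 0 < g) (hg1 : g < 1)
    {q p : ℤ} (hq : q ≠ 0) (hqN : |q| ≤ N) (h : |g * q - p| ≤ δ) : g ∈ nearFractions N δ := by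
  rcases lt_or_gt_of_ne hq with hneg | hpos
  · refine mem_nearFractions hδ hg0 hg1 (q := -q) (p := -p) (by omega)
      ((neg_le_abs q).trans hqN) ?_
    rw [← abs_neg]
    push_cast
    convert h using 2
    ring
  · exact mem_nearFractions hδ hg0 hg1 hpos ((le_abs_self q).trans hqN) h

/-- Here `r` is the sixth root of the signal-to-noise ratio and `T` the claimed lower bound. If a
nonzero integer triple violates the bound, then `a₃ / a₁` approximates `g` unusually well. -/
lemma approximation_of_small_noise {r u g s T β : ℝ} {a₁ a₂ a₃ : ℤ} (hr : 1 ≤ r)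
    (hr4 : 2 ≤ r ^ 4) (hu0 : 0 < u) (hu1 : u ≤ 1) (hg0 : 0 < g) (hg1 : g < 1)
    (hgr : 1 ≤ g * r) (hs0 : 0 < s) (hs : s ^ 2 = g ^ 2 * r ^ 6 - 1)
    (hT : T * g = u ^ 2 / 1024 * r ^ 3) (ha : ¬(a₁ = 0 ∧ a₂ = 0 ∧ a₃ = 0))
    (h : 2 * β ^ 2 + ((β - a₁) ^ 2 + (β / s - a₂) ^ 2 + (β * g - a₃) ^ 2) * r ^ 6 < T) :
    a₁ ≠ 0 ∧ (a₁ : ℝ) ^ 2 ≤ 2 * T ∧ (g * a₁ - a₃) ^ 2 * r ^ 6 ≤ 2 * T := by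
  have hr0 : 0 < r := by linarith
  have hr6 : 0 < r ^ 6 := by positivity
  have hr3 : 0 < r ^ 3 := by positivity
  have hu2 : u ^ 2 ≤ 1 := by nlinarith
  have hT0 : 0 < T := by
    refine pos_of_mul_pos_left ?_ hg0.le
    rw [hT]
    positivity
  have hTr : 1024 * T ≤ r ^ 6 := by
    have h1 : 1024 * T * g ≤ r ^ 3 := by
      linarith [mul_le_of_le_one_left hr3.le hu2]
    have h2 : r ^ 3 ≤ r ^ 4 * g := by
      linarith [le_mul_of_one_le_left hr3.le hgr, show g * r * r ^ 3 = r ^ 4 * g by ring]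
    have h3 : 1024 * T ≤ r ^ 4 := le_of_mul_le_mul_right (h1.trans h2) hg0
    exact h3.trans (pow_le_pow_right₀ hr (by norm_num))
  have p1 : 0 ≤ (β - a₁) ^ 2 * r ^ 6 := by positivity
  have p2 : 0 ≤ (β / s - a₂) ^ 2 * r ^ 6 := by positivity
  have p3 : 0 ≤ (β * g - a₃) ^ 2 * r ^ 6 := by positivity
  have p4 := sq_nonneg β
  have small : ∀ x : ℝ, x ^ 2 * r ^ 6 < T → |x| < 1 / 32 := by
    intro x hx
    have : x ^ 2 < (1 / 32) ^ 2 := by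
      refine lt_of_mul_lt_mul_right ?_ hr6.le
      linarith
    exact abs_lt_of_sq_lt_sq this (by norm_num)
  obtain ⟨l1, m1⟩ := abs_lt.1 (small (β - a₁) (by linarith))
  obtain ⟨l2, m2⟩ := abs_lt.1 (small (β / s - a₂) (by linarith))
  obtain ⟨l3, m3⟩ := abs_lt.1 (small (β * g - a₃) (by linarith))
  have hβs : |β / s| < 1 / 32 := by
    apply abs_lt_of_sq_lt_sq _ (by norm_num)
    rw [div_pow, div_lt_iff₀ (by positivity)]
    have hg2 : 1 ≤ (g * r) ^ 2 := one_le_pow₀ hgr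
    have hg3 : 1 ≤ (g * r) ^ 3 := one_le_pow₀ hgr
    have e1 : 2 ≤ g ^ 2 * r ^ 6 := by
      have : g ^ 2 * r ^ 6 = (g * r) ^ 2 * r ^ 4 := by ring
      rw [this]
      exact hr4.trans (le_mul_of_one_le_left (by positivity) hg2)
    have e2 : T ≤ (1 / 1024) * (g ^ 2 * r ^ 6) := by
      refine le_of_mul_le_mul_right ?_ hg0
      have : (1 / 1024) * (g ^ 2 * r ^ 6) * g = (1 / 1024) * ((g * r) ^ 3 * r ^ 3) := by ring
      rw [this, hT]
      have h1 : u ^ 2 * r ^ 3 ≤ r ^ 3 := mul_le_of_le_one_left hr3.le hu2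
      have h2 : r ^ 3 ≤ (g * r) ^ 3 * r ^ 3 := le_mul_of_one_le_left hr3.le hg3
      linarith
    have e3 : 2 * β ^ 2 < T := by linarith
    rw [hs]
    linarith
  obtain ⟨l4, m4⟩ := abs_lt.1 hβs
  have int_zero : ∀ a : ℤ, -1 < (a : ℝ) → (a : ℝ) < 1 → a = 0 := by
    intro a h1 h2
    have h1 : -1 < a := by exact_mod_cast h1
    have h2 : a < 1 := by exact_mod_cast h2
    omega
  have ha2 : a₂ = 0 := int_zero _ (by linarith) (by linarith)
  have ha1 : a₁ ≠ 0 := by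
    rintro rfl
    simp only [Int.cast_zero, sub_zero] at l1 m1
    have h1 : |β * g| ≤ 1 / 32 := by
      rw [abs_mul, abs_of_pos hg0]
      exact (mul_le_of_le_one_right (abs_nonneg _) hg1.le).trans (abs_le.2 ⟨l1.le, m1.le⟩)
    obtain ⟨h2, h3⟩ := abs_le.1 h1
    exact ha ⟨rfl, ha2, int_zero _ (by linarith) (by linarith)⟩
  have hone : (1 : ℝ) ≤ |(a₁ : ℝ)| := by exact_mod_cast Int.one_le_abs ha1
  refine ⟨ha1, ?_, ?_⟩
  · have : |(a₁ : ℝ)| ≤ 2 * |β| := by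
      have h1 : |(a₁ : ℝ)| - |β| ≤ |(a₁ : ℝ) - β| := abs_sub_abs_le_abs_sub _ _
      have h2 : |(a₁ : ℝ) - β| < 1 / 32 := abs_lt.2 ⟨by linarith, by linarith⟩
      linarith
    have := pow_le_pow_left₀ (abs_nonneg _) this 2
    rw [mul_pow, sq_abs, sq_abs] at this
    linarith
  · have e : (g * a₁ - a₃) ^ 2 ≤ 2 * ((β - a₁) ^ 2 + (β * g - a₃) ^ 2) := by
      have : (g * (β - a₁)) ^ 2 ≤ (β - a₁) ^ 2 := by
        rw [mul_pow]
        exact mul_le_of_le_one_left (sq_nonneg _) (pow_le_one₀ hg0.le hg1.le)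
      have key : (g * a₁ - a₃) ^ 2 + (g * (β - a₁) + (β * g - a₃)) ^ 2
          = 2 * ((g * (β - a₁)) ^ 2 + (β * g - a₃) ^ 2) := by ring
      linarith [sq_nonneg (g * (β - a₁) + (β * g - a₃))]
    have := mul_le_mul_of_nonneg_right e hr6.le
    linarith

/-- Moderately weak interference regime: for `SNR > 4` and `c > 0` there is a measurable
outage set `S ⊆ (0,1)` of Lebesgue measure at most `2^{−c}` such that for every `K ≥ 2`
and every `g ∈ (0,1) ∖ S` with `g² ≥ SNR^{−1/3}`, the effective Han–Kobayashi noise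
variance is at least `2^{−2c}·2^{−10}·√SNR/g` for all `β` and nonzero integer triples. -/
theorem stmt8 (SNR c : ℝ) (hSNR : 4 < SNR) (hc : 0 < c) :
    ∃ S : Set ℝ, S ⊆ Set.Ioo 0 1 ∧ MeasurableSet S ∧
      volume S ≤ ENNReal.ofReal ((2 : ℝ) ^ (-c : ℝ)) ∧
      ∀ K : ℕ, 2 ≤ K → ∀ g ∈ Set.Ioo (0 : ℝ) 1 \ S, SNR ^ (-(1 : ℝ) / 3) ≤ g ^ 2 →
        ∀ (β : ℝ) (a₁ a₂ a₃ : ℤ), ¬(a₁ = 0 ∧ a₂ = 0 ∧ a₃ = 0) →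
          (K : ℝ) * β ^ 2 +
              ((β - (a₁ : ℝ)) ^ 2 + (β / Real.sqrt (g ^ 2 * SNR - 1) - (a₂ : ℝ)) ^ 2 +
                ((K : ℝ) - 1) * (β * g - (a₃ : ℝ)) ^ 2) * SNR
            ≥ (2 : ℝ) ^ (-(2 * c) : ℝ) * (2 : ℝ) ^ (-(10 : ℝ)) * Real.sqrt SNR / g := by
  obtain ⟨r, hr1, hr6⟩ : ∃ r : ℝ, 1 ≤ r ∧ r ^ 6 = SNR := by
    refine ⟨SNR ^ ((1 : ℝ) / 6), Real.one_le_rpow (by linarith) (by norm_num), ?_⟩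
    rw [← Real.rpow_natCast, ← Real.rpow_mul (by linarith)]
    norm_num
  have hr0 : 0 < r := by linarith
  have hsqrt : Real.sqrt SNR = r ^ 3 := by
    rw [← hr6, show r ^ 6 = (r ^ 3) ^ 2 by ring, Real.sqrt_sq (by positivity)]
  have hcube : SNR ^ (-(1 : ℝ) / 3) = (r ^ 2)⁻¹ := by
    rw [← hr6, ← Real.rpow_natCast, ← Real.rpow_mul hr0.le, ← Real.rpow_natCast,
      ← Real.rpow_neg hr0.le]
    norm_num
  have hr4 : 2 ≤ r ^ 4 := by
    by_contra! hcon
    have h1 : (r ^ 4) ^ 3 < 2 ^ 3 := pow_lt_pow_left₀ hcon (by positivity) (by norm_num)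
    have h2 : (r ^ 4) ^ 3 = SNR ^ 2 := by rw [← hr6]; ring
    nlinarith
  set u : ℝ := (2 : ℝ) ^ (-c : ℝ) with hu
  have hu0 : 0 < u := by positivity
  have hu1 : u ≤ 1 := Real.rpow_le_one_of_one_le_of_nonpos (by norm_num) (by linarith)
  have hu2 : (2 : ℝ) ^ (-(2 * c) : ℝ) = u ^ 2 := by
    rw [hu, ← Real.rpow_natCast, ← Real.rpow_mul (by norm_num)]
    congr 1
    push_cast
    ring
  have h10 : (2 : ℝ) ^ (-(10 : ℝ)) = 1 / 1024 := by
    rw [Real.rpow_neg (by norm_num)]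
    norm_num
  set Q : ℝ := Real.sqrt (u * r ^ 3 / 256) with hQ
  have hQ2 : Q ^ 2 = u * r ^ 3 / 256 := Real.sq_sqrt (by positivity)
  have hQ0 : 0 ≤ Q := Real.sqrt_nonneg _
  have hr3 : 1 ≤ r ^ 3 := one_le_pow₀ hr1
  have hδ : Q / r ^ 3 < 1 := by
    rw [div_lt_one (by positivity)]
    apply lt_of_pow_lt_pow_left₀ 2 (by positivity)
    nlinarith
  refine ⟨Set.Ioo 0 1 ∩ (Set.Iic (u / 2) ∪ nearFractions ⌊Q⌋₊ (Q / r ^ 3)),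
    Set.inter_subset_left,
    measurableSet_Ioo.inter (measurableSet_Iic.union (measurableSet_nearFractions _ _)), ?_, ?_⟩
  · have hsub : Set.Ioo 0 1 ∩ (Set.Iic (u / 2) ∪ nearFractions ⌊Q⌋₊ (Q / r ^ 3)) ⊆
        Set.Icc 0 (u / 2) ∪ nearFractions ⌊Q⌋₊ (Q / r ^ 3) := by
      rintro x ⟨hx, hx' | hx'⟩
      · exact Or.inl ⟨hx.1.le, hx'⟩
      · exact Or.inr hx'
    refine (measure_mono hsub).trans ((measure_union_le _ _).trans ?_)
    refine (add_le_add_right (volume_nearFractions_le _ (by positivity)) _).trans ?_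
    rw [Real.volume_Icc, ← ENNReal.ofReal_add (by linarith) (by positivity)]
    apply ENNReal.ofReal_le_ofReal
    have h1 : (⌊Q⌋₊ : ℝ) * (Q / r ^ 3) ≤ Q * (Q / r ^ 3) :=
      mul_le_mul_of_nonneg_right (Nat.floor_le hQ0) (by positivity)
    have h2 : Q * (Q / r ^ 3) = u / 256 := by
      rw [← mul_div_assoc, ← sq, hQ2]
      field_simp
    linarith
  · rintro K hK g ⟨⟨hg0, hg1⟩, hgS⟩ hg β a₁ a₂ a₃ ha
    by_contra! hcon
    rw [hcube] at hg
    rw [hu2, h10, hsqrt, ← hr6] at hcon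
    have hgr : 1 ≤ g * r := by
      apply le_of_sq_le_sq _ (by positivity)
      rw [inv_le_iff_one_le_mul₀ (by positivity)] at hg
      linarith [mul_pow g r 2]
    have hgu : u / 2 < g := by
      by_contra! hle
      exact hgS ⟨⟨hg0, hg1⟩, Or.inl hle⟩
    have hpos : 0 < g ^ 2 * r ^ 6 - 1 := by
      have h1 : 1 ≤ (g * r) ^ 2 := one_le_pow₀ hgr
      nlinarith [show g ^ 2 * r ^ 6 = (g * r) ^ 2 * r ^ 4 by ring]
    have hK' : (2 : ℝ) ≤ K := by exact_mod_cast hK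
    set T : ℝ := u ^ 2 * (1 / 1024) * r ^ 3 / g with hTdef
    have hT : T * g = u ^ 2 / 1024 * r ^ 3 := by
      rw [hTdef]
      field_simp
    have hTQ : 2 * T ≤ Q ^ 2 := by
      rw [hQ2]
      refine le_of_mul_le_mul_right ?_ hg0
      have : 0 < u * r ^ 3 := by positivity
      nlinarith
    obtain ⟨ha1, hb, hd⟩ := approximation_of_small_noise hr1 hr4 hu0 hu1 hg0 hg1 hgr
      (Real.sqrt_pos.2 hpos) (Real.sq_sqrt hpos.le) hT ha (β := β) (by
        refine lt_of_le_of_lt ?_ hcon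
        have h1 : (β * g - a₃) ^ 2 ≤ ((K : ℝ) - 1) * (β * g - a₃) ^ 2 :=
          le_mul_of_one_le_left (sq_nonneg _) (by linarith)
        gcongr)
    refine hgS ⟨⟨hg0, hg1⟩, Or.inr (mem_nearFractions_of_ne_zero hδ hg0 hg1 ha1 ?_ (p := a₃) ?_)⟩
    · rw [Int.abs_eq_natAbs]
      have : (a₁.natAbs : ℝ) ≤ Q := by
        rw [Nat.cast_natAbs, Int.cast_abs]
        exact abs_le_of_sq_le_sq (hb.trans hTQ) hQ0
      exact_mod_cast Nat.le_floor this
    · apply abs_le_of_sq_le_sq _ (by positivity)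
      rw [div_pow, le_div_iff₀ (by positivity), ← pow_mul]
      exact hd.trans hTQ
end

section
/- Let K ≥ 1 be an integer and let A be a K×K matrix with integer entries, all of absolute value at most a_max, where a_max ≥ 1 is an integer. Suppose there exist a real K×K lower-triangular matrix L with all diagonal entries equal to 1 and a permutation π of {1, …, K} such that the matrix Ã = L·A satisfies Ã_{i, π(j)} = 0 for all i > j and Ã_{i, π(i)} ≠ 0 for all i. Then for every prime p > K·(K!)²·(K·a_max)^{2K}·a_max there exists a K×K lower-triangular integer matrix L⁽ᵖ⁾ with entries in {0, 1, …, p−1} and all diagonal entries equal to 1 such that the matrix L⁽ᵖ⁾·A, with entries reduced modulo p, satisfies (L⁽ᵖ⁾·A)_{i, π(j)} ≡ 0 (mod p) for all i > j and (L⁽ᵖ⁾·A)_{i, π(i)} ≢ 0 (mod p) for all i. -/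
open Matrix

/-- The matrix whose rows of index less than `k` are those of `B`, the other rows being those of
the identity; its determinant is the leading principal minor of `B` of order `k`. -/
def leadingRows {R : Type*} [Zero R] [One R] {K : ℕ} (B : Matrix (Fin K) (Fin K) R) (k : ℕ) :
    Matrix (Fin K) (Fin K) R :=
  fun r => if (r : ℕ) < k then B r else Pi.single r 1

lemma leadingRows_map {R S : Type*} [Ring R] [Ring S] (f : R →+* S) {K : ℕ}
    (B : Matrix (Fin K) (Fin K) R) (k : ℕ) :
    leadingRows (B.map f) k = f.mapMatrix (leadingRows B k) := by
  ext r c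
  by_cases h : (r : ℕ) < k
  · simp [leadingRows, h]
  · simp [leadingRows, h, Pi.single_apply, apply_ite f]

lemma leadingRows_eq_updateRow {R : Type*} [Zero R] [One R] {K : ℕ}
    (B : Matrix (Fin K) (Fin K) R) (i : Fin K) :
    leadingRows B i = (leadingRows B (i + 1)).updateRow i (Pi.single i 1) := by
  ext r c
  rcases eq_or_ne r i with rfl | h
  · simp [leadingRows]
  · have h' : (r : ℕ) ≠ i := fun e => h (Fin.ext e)
    have h'' : (r : ℕ) < i + 1 ↔ (r : ℕ) < i := by omega
    simp [leadingRows, Matrix.updateRow_ne h, h'']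

/-- If a unit lower-triangular `L` makes `L * B` upper triangular with nonzero diagonal, then all
leading principal minors of `B` are nonzero. -/
lemma det_leadingRows_ne_zero {F : Type*} [Field F] {K : ℕ} {B L : Matrix (Fin K) (Fin K) F}
    (hLtri : ∀ i j, i < j → L i j = 0)
    (hzero : ∀ i j, j < i → (L * B) i j = 0) (hpivot : ∀ i, (L * B) i i ≠ 0) (k : ℕ) :
    (leadingRows B k).det ≠ 0 := by
  have hprod : leadingRows L k * leadingRows B k = leadingRows (L * B) k := by
    ext r c
    by_cases hr : (r : ℕ) < k
    · simp only [leadingRows, hr, if_true, Matrix.mul_apply]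
      refine Finset.sum_congr rfl fun j _ => ?_
      rcases lt_or_ge r j with h | h
      · simp [hLtri r j h]
      · have hj : (j : ℕ) < k := lt_of_le_of_lt h hr
        simp [hj]
    · simp [leadingRows, hr, Matrix.mul_apply, Pi.single_apply]
  have htri : (leadingRows (L * B) k).BlockTriangular id := by
    intro i j (hij : j < i)
    by_cases hi : (i : ℕ) < k
    · simpa [leadingRows, hi] using hzero i j hij
    · simp [leadingRows, hi, hij.ne]
  have hdet : (leadingRows (L * B) k).det ≠ 0 := by
    rw [Matrix.det_of_isUpperTriangular htri, Finset.prod_ne_zero_iff]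
    intro i _
    by_cases hi : (i : ℕ) < k
    · simpa [leadingRows, hi] using hpivot i
    · simp [leadingRows, hi]
  rw [← hprod, Matrix.det_mul] at hdet
  exact right_ne_zero_of_mul hdet

/-- Gaussian elimination without pivoting: a matrix over a field whose leading principal minors
are nonzero is made upper triangular by a unit lower-triangular matrix. -/
lemma exists_lowerTriangular_mul_upperTriangular {F : Type*} [Field F] {K : ℕ}
    {B : Matrix (Fin K) (Fin K) F} (hdet : ∀ k, (leadingRows B k).det ≠ 0) :
    ∃ M : Matrix (Fin K) (Fin K) F,
      (∀ i j, i < j → M i j = 0) ∧ (∀ i, M i i = 1) ∧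
      (∀ i j, j < i → (M * B) i j = 0) ∧ (∀ i, (M * B) i i ≠ 0) := by
  have hdiag (i : Fin K) : (leadingRows B (i + 1)).adjugate i i = (leadingRows B i).det := by
    rw [Matrix.adjugate_apply, ← leadingRows_eq_updateRow]
  let M : Matrix (Fin K) (Fin K) F := fun i j =>
    if j ≤ i then (leadingRows B i).det⁻¹ * (leadingRows B (i + 1)).adjugate i j else 0
  have hM (i c : Fin K) (hc : c ≤ i) : (M * B) i c =
      (leadingRows B i).det⁻¹ * ((leadingRows B (i + 1)).det * (1 : Matrix _ _ F) i c) := by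
    rw [← smul_eq_mul (leadingRows B (i + 1)).det, ← Matrix.smul_apply, ← Matrix.adjugate_mul,
      Matrix.mul_apply, Matrix.mul_apply, Finset.mul_sum]
    refine Finset.sum_congr rfl fun j _ => ?_
    by_cases hj : j ≤ i
    · have hj' : (j : ℕ) < i + 1 := Nat.lt_succ_of_le hj
      simp [M, hj, leadingRows, hj', mul_assoc]
    · have hj' : ¬ (j : ℕ) < i + 1 := fun h => hj (Nat.le_of_lt_succ h)
      have hcj : c ≠ j := fun h => hj (h ▸ hc)
      have hz : leadingRows B (i + 1) j c = 0 := by simp [leadingRows, hj', hcj]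
      simp [M, hj, hz]
  refine ⟨M, fun i j hij => by simp [M, hij.not_ge], fun i => ?_, fun i j hij => ?_, fun i => ?_⟩
  · simp [M, hdiag, hdet]
  · simp [hM i j hij.le, hij.ne']
  · simp [hM i i le_rfl, hdet]

/-- If the integer matrix `A` (entries bounded by `a_max`) can be pseudo-triangularized
over `ℝ` with permutation `π` by a lower-triangular unit-diagonal matrix, then for every
prime `p > K·(K!)²·(K·a_max)^{2K}·a_max` there is a lower-triangular integer matrix
`L⁽ᵖ⁾` with entries in `{0,…,p−1}` and unit diagonal such that `L⁽ᵖ⁾·A` is, modulo `p`,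
upper triangular up to the column permutation `π` with nonzero pivots. -/
theorem stmt9 (K : ℕ) (hK : 1 ≤ K) (A : Matrix (Fin K) (Fin K) ℤ) (amax : ℤ)
    (hamax : 1 ≤ amax) (hA : ∀ i j, |A i j| ≤ amax)
    (L : Matrix (Fin K) (Fin K) ℝ) (hLtri : ∀ i j : Fin K, i < j → L i j = 0)
    (hLdiag : ∀ i, L i i = 1) (π : Equiv.Perm (Fin K))
    (hzero : ∀ i j : Fin K, j < i → (L * A.map (Int.cast : ℤ → ℝ)) i (π j) = 0)
    (hpivot : ∀ i : Fin K, (L * A.map (Int.cast : ℤ → ℝ)) i (π i) ≠ 0)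
    (p : ℕ) (hp : p.Prime)
    (hplarge : (K : ℤ) * (Nat.factorial K : ℤ) ^ 2 * ((K : ℤ) * amax) ^ (2 * K) * amax
      < (p : ℤ)) :
    ∃ Lp : Matrix (Fin K) (Fin K) ℤ,
      (∀ i j, 0 ≤ Lp i j ∧ Lp i j < (p : ℤ)) ∧
      (∀ i j : Fin K, i < j → Lp i j = 0) ∧
      (∀ i, Lp i i = 1) ∧
      (∀ i j : Fin K, j < i → (p : ℤ) ∣ (Lp * A) i (π j)) ∧
      (∀ i : Fin K, ¬ (p : ℤ) ∣ (Lp * A) i (π i)) := by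
  have : Fact p.Prime := ⟨hp⟩
  let B : Matrix (Fin K) (Fin K) ℤ := A.submatrix id π
  have hreal (k : ℕ) : (leadingRows B k).det ≠ 0 := by
    have h := det_leadingRows_ne_zero (B := B.map (Int.castRingHom ℝ)) hLtri hzero hpivot k
    rw [leadingRows_map, ← RingHom.map_det] at h
    exact fun h0 => h (by rw [h0, map_zero])
  have hbound (k : ℕ) : |(leadingRows B k).det| < (p : ℤ) := by
    have hentry (i j : Fin K) : AbsoluteValue.abs (leadingRows B k i j) ≤ amax := by
      rw [AbsoluteValue.abs_apply]
      by_cases hi : (i : ℕ) < k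
      · simpa [leadingRows, hi, B] using hA i (π j)
      · by_cases hij : j = i
        · simpa [leadingRows, hi, hij] using hamax
        · simpa [leadingRows, hi, hij] using zero_le_one.trans hamax
    have hle := Matrix.det_le hentry
    rw [AbsoluteValue.abs_apply, Fintype.card_fin, nsmul_eq_mul] at hle
    refine hle.trans_lt (lt_of_le_of_lt ?_ hplarge)
    have hK' : (1 : ℤ) ≤ K := by exact_mod_cast hK
    have hf : (1 : ℤ) ≤ K.factorial := by exact_mod_cast K.factorial_pos
    have hKa : amax ≤ K * amax := le_mul_of_one_le_left (by linarith) hK'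
    have hpow : amax ^ K ≤ (K * amax) ^ (2 * K) :=
      (pow_le_pow_left₀ (by linarith) hKa K).trans
        (pow_le_pow_right₀ (hamax.trans hKa) (by omega))
    have hfac : (K.factorial : ℤ) ≤ K * (K.factorial : ℤ) ^ 2 :=
      (le_self_pow₀ hf two_ne_zero).trans (le_mul_of_one_le_left (by positivity) hK')
    calc (K.factorial : ℤ) * amax ^ K
        ≤ K * (K.factorial : ℤ) ^ 2 * (K * amax) ^ (2 * K) := by gcongr
      _ ≤ _ := le_mul_of_one_le_right (by positivity) hamax
  have hmod (k : ℕ) : (leadingRows (B.map (Int.castRingHom (ZMod p))) k).det ≠ 0 := by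
    rw [leadingRows_map, ← RingHom.map_det, eq_intCast, Ne, ZMod.intCast_zmod_eq_zero_iff_dvd]
    exact fun h => hreal k (Int.eq_zero_of_abs_lt_dvd h (hbound k))
  obtain ⟨M, hMtri, hMdiag, hMzero, hMpivot⟩ := exists_lowerTriangular_mul_upperTriangular hmod
  let Lp : Matrix (Fin K) (Fin K) ℤ := fun i j => ((M i j).val : ℤ)
  have hcast (i j : Fin K) : (((Lp * A) i (π j) : ℤ) : ZMod p) =
      (M * B.map (Int.castRingHom (ZMod p))) i j := by
    have hLp (j : Fin K) : ((Lp i j : ℤ) : ZMod p) = M i j := by simp [Lp]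
    simp [Matrix.mul_apply, hLp, B]
  refine ⟨Lp, fun i j => ⟨by positivity, Int.ofNat_lt.2 (ZMod.val_lt (M i j))⟩,
    fun i j hij => by simp [Lp, hMtri i j hij], fun i => ?_, fun i j hij => ?_, fun i => ?_⟩
  · have : Fact (1 < p) := ⟨hp.one_lt⟩
    simp only [Lp, hMdiag, ZMod.val_one, Nat.cast_one]
  · rw [← ZMod.intCast_zmod_eq_zero_iff_dvd, hcast, hMzero i j hij]
  · rw [← ZMod.intCast_zmod_eq_zero_iff_dvd, hcast]
    exact hMpivot i
end

section
/- Let L ≥ 2 be an integer, let SNR > 0, let g ∈ ℝ^L, let b₁², …, b_L² be positive reals, and set κ := (1 + SNR·g_L²·b_L²)^{−1/2}. For any a₁, …, a_{L−1} ∈ ℝ, let ā ∈ ℝ^L be the vector with ā_ℓ = a_ℓ for ℓ ≤ L−1 and ā_L = 0. Then inf_{β ∈ ℝ} (SNR·∑_{ℓ=1}^L b_ℓ²·(β·g_ℓ − ā_ℓ)² + β²) = inf_{β ∈ ℝ} (SNR·∑_{ℓ=1}^{L−1} b_ℓ²·(β·κ·g_ℓ − a_ℓ)² + β²). -/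
open Finset

/-- For an effective `L`-user MAC (`L = n+1 ≥ 2`) with gains `g`, positive weights `b`,
and `κ = (1 + SNR·g_L²·b_L²)^{−1/2}`, the effective noise variance of any coefficient
vector whose last entry is zero equals the effective noise variance of the truncated
coefficient vector over the `(L−1)`-user channel with gains scaled by `κ`. -/
theorem stmt12 (n : ℕ) (hn : 1 ≤ n) (SNR : ℝ) (hSNR : 0 < SNR)
    (g b : Fin (n + 1) → ℝ) (hb : ∀ ℓ, 0 < b ℓ) (a : Fin n → ℝ) :
    let κ : ℝ := 1 / Real.sqrt (1 + SNR * (g (Fin.last n)) ^ 2 * b (Fin.last n))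
    let abar : Fin (n + 1) → ℝ := Fin.snoc a 0
    (⨅ β : ℝ, SNR * (∑ ℓ, b ℓ * (β * g ℓ - abar ℓ) ^ 2) + β ^ 2)
      = ⨅ β : ℝ, SNR * (∑ ℓ : Fin n, b ℓ.castSucc * (β * κ * g ℓ.castSucc - a ℓ) ^ 2)
          + β ^ 2 := by
  intro κ abar
  have hD : 0 < 1 + SNR * (g (Fin.last n)) ^ 2 * b (Fin.last n) := by
    have := hb (Fin.last n)
    positivity
  set s := Real.sqrt (1 + SNR * (g (Fin.last n)) ^ 2 * b (Fin.last n))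
  have hs0 : s ≠ 0 := (Real.sqrt_pos.2 hD).ne'
  have hsq : s ^ 2 = 1 + SNR * (g (Fin.last n)) ^ 2 * b (Fin.last n) := Real.sq_sqrt hD.le
  refine (mul_left_surjective₀ hs0).iInf_congr (fun β => s * β) fun β => ?_
  have hκ : s * β * κ = β := by
    rw [show κ = 1 / s from rfl]
    field_simp
  simp only [hκ, Fin.sum_univ_castSucc, abar, Fin.snoc_castSucc, Fin.snoc_last, mul_pow, hsq]
  ring
end

section
/- Let K ≥ 1 be an integer. For Lebesgue-almost every h ∈ ℝ^K, limsup_{SNR → ∞} R₁(h; SNR) / ((1/2)·log₂(1 + SNR)) ≤ 1/K, where R₁(h; SNR) := sup over a ∈ ℤ^K ∖ {0} of (1/2)·log₂(SNR / σ²_eff(h, a; SNR)). -/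
open Finset MeasureTheory

/-- The slab of vectors in a cube that are nearly parallel to `a` has small volume. -/
lemma volume_nearly_parallel_le {K : ℕ} (a : Fin K → ℝ) (j : Fin K) (hj : a j ≠ 0)
    {M δ : ℝ} (hM : 0 ≤ M) (hδ : 0 ≤ δ) :
    volume {h : Fin K → ℝ | (∀ i, |h i| ≤ M) ∧ ∀ i, |a j * h i - a i * h j| ≤ δ} ≤
      ENNReal.ofReal (2 * M * (2 * (δ / |a j|)) ^ (K - 1)) := by
  set v : Fin K → ℝ := fun i => if i = j then 0 else -(a i / a j) with hv
  set L : (Fin K → ℝ) →ₗ[ℝ] (Fin K → ℝ) :=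
    LinearMap.transvection (LinearMap.proj (R := ℝ) (φ := fun _ : Fin K => ℝ) j) v with hL
  have hdet : LinearMap.det L = 1 := by
    rw [hL, LinearMap.transvection.det]
    simp [hv]
  set r : Fin K → ℝ := Function.update (fun _ => δ / |a j|) j M with hr
  have hsub : {h : Fin K → ℝ | (∀ i, |h i| ≤ M) ∧ ∀ i, |a j * h i - a i * h j| ≤ δ} ⊆
      L ⁻¹' Set.Icc (-r) r := by
    rintro h ⟨h1, h2⟩
    have key : ∀ i, |L h i| ≤ r i := by
      intro i
      by_cases hij : i = j
      · subst hij
        simpa [hL, hv, hr, LinearMap.transvection] using h1 i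
      · have : L h i = (a j * h i - a i * h j) / a j := by
          simp only [hL, hv, LinearMap.transvection, LinearMap.coe_mk, AddHom.coe_mk,
            LinearMap.proj_apply, Pi.add_apply, Pi.smul_apply, smul_eq_mul, if_neg hij]
          field_simp
          ring
        rw [this, abs_div, hr, Function.update_of_ne hij]
        gcongr
        exact h2 i
    exact ⟨fun i => (abs_le.mp (key i)).1, fun i => (abs_le.mp (key i)).2⟩
  refine (measure_mono hsub).trans ?_
  rw [Measure.addHaar_preimage_linearMap _ (by rw [hdet]; exact one_ne_zero), hdet,
    Real.volume_Icc_pi, ← ENNReal.ofReal_prod_of_nonneg]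
  · rw [← Finset.mul_prod_erase _ _ (Finset.mem_univ j),
      Finset.prod_congr rfl (g := fun _ => 2 * (δ / |a j|))]
    · simp only [hr, inv_one, abs_one, ENNReal.ofReal_one, one_mul, Pi.neg_apply,
        Function.update_self, Finset.prod_const, Finset.card_erase_of_mem (Finset.mem_univ j),
        Finset.card_univ, Fintype.card_fin]
      apply le_of_eq
      ring_nf
    · intro i hi
      simp only [hr, Pi.neg_apply, Function.update_of_ne (Finset.ne_of_mem_erase hi)]
      ring
  · intro i _
    by_cases hij : i = j
    · subst hij
      simp only [hr, Pi.neg_apply, Function.update_self]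
      linarith
    · simp only [hr, Pi.neg_apply, Function.update_of_ne hij]
      have : 0 ≤ δ / |a j| := by positivity
      linarith

lemma summable_int_pi_norm_rpow (K : ℕ) {r : ℝ} (hr : r < -K) :
    Summable fun a : Fin K → ℤ => ‖a‖ ^ r := by
  set b := Pi.basisFun ℝ (Fin K)
  set L : Submodule ℤ (Fin K → ℝ) := Submodule.span ℤ (Set.range b)
  have hrank : Module.finrank ℤ L = K := by
    rw [ZLattice.rank ℝ]; simp
  have hsum := ZLattice.summable_norm_rpow L r (by rwa [hrank])
  have hmem : ∀ a : Fin K → ℤ, (fun i => (a i : ℝ)) ∈ L := by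
    intro a
    rw [b.mem_span_iff_repr_mem ℤ]
    intro i
    exact ⟨a i, by simp [b]⟩
  have hinj : Function.Injective fun a : Fin K → ℤ => (⟨fun i => (a i : ℝ), hmem a⟩ : L) := by
    intro a a' h
    ext i
    have := congrFun (congrArg Subtype.val h) i
    simpa using this
  refine (hsum.comp_injective hinj).congr fun a => ?_
  simp only [Function.comp_apply, Submodule.coe_norm]
  congr 1

/-- Khinchine-type bound: almost every vector is badly parallel to every integer vector. -/
lemma ae_exists_lt_abs_wedge {K : ℕ} (hK : 2 ≤ K) {ε : ℝ} (hε : 0 < ε) :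
    ∀ᵐ h : Fin K → ℝ ∂volume, ∃ c : ℝ, 0 < c ∧ ∀ a : Fin K → ℤ, a ≠ 0 →
      ∃ i j, c * ‖a‖ ^ (-((1 + ε) / (K - 1))) < |(a j : ℝ) * h i - a i * h j| := by
  set s : ℝ := (1 + ε) / (K - 1) with hs
  have hK1 : (0 : ℝ) < K - 1 := by
    have : (2 : ℝ) ≤ K := by exact_mod_cast hK
    linarith
  set B : ℕ → Set (Fin K → ℝ) := fun M => {h | (∀ i, |h i| ≤ M) ∧ ∀ n : ℕ,
    ∃ a : Fin K → ℤ, a ≠ 0 ∧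
      ∀ i j, |(a j : ℝ) * h i - a i * h j| ≤ 1 / ((n : ℝ) + 1) * ‖a‖ ^ (-s)} with hB
  have hB0 : ∀ M, volume (B M) = 0 := by
    intro M
    set g : (Fin K → ℤ) → ℝ := fun a => 2 * M * 2 ^ (K - 1) * ‖a‖ ^ (-(K + ε)) with hg
    have hgs : Summable g := (summable_int_pi_norm_rpow K (by linarith)).mul_left _
    have hg0 : ∀ a, 0 ≤ g a := fun a => by positivity
    have hbound : ∀ n : ℕ, volume (B M) ≤ ENNReal.ofReal (1 / ((n : ℝ) + 1) * ∑' a, g a) := by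
      intro n
      set c : ℝ := 1 / ((n : ℝ) + 1) with hc
      have hc0 : 0 < c := Nat.one_div_pos_of_nat
      have hc1 : c ≤ 1 := by
        rw [hc, div_le_one (by positivity)]
        linarith [(Nat.cast_nonneg n : (0 : ℝ) ≤ n)]
      have hsub : B M ⊆ ⋃ a : Fin K → ℤ, {h : Fin K → ℝ | a ≠ 0 ∧ (∀ i, |h i| ≤ M) ∧
          ∀ i j, |(a j : ℝ) * h i - a i * h j| ≤ c * ‖a‖ ^ (-s)} := by
        rintro h ⟨h1, h2⟩
        obtain ⟨a, ha, h3⟩ := h2 n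
        exact Set.mem_iUnion.2 ⟨a, ha, h1, h3⟩
      refine (measure_mono hsub).trans ((measure_iUnion_le _).trans ?_)
      rw [← tsum_mul_left, ENNReal.ofReal_tsum_of_nonneg (fun a => mul_nonneg hc0.le (hg0 a))
        (hgs.mul_left c)]
      refine ENNReal.tsum_le_tsum fun a => ?_
      by_cases ha : a = 0
      · simp [ha]
      have hpos : 0 < ‖a‖ := norm_pos_iff.2 ha
      obtain ⟨j, -, hj⟩ := Finset.exists_max_image Finset.univ (fun i => ‖a i‖)
        ⟨(⟨0, by omega⟩ : Fin K), Finset.mem_univ _⟩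
      have hnorm : |(a j : ℝ)| = ‖a‖ := by
        rw [← Int.norm_eq_abs]
        exact le_antisymm (norm_le_pi_norm a j)
          ((pi_norm_le_iff_of_nonneg (norm_nonneg _)).2 fun i => hj i (Finset.mem_univ i))
      have haj : (a j : ℝ) ≠ 0 := by
        rw [← abs_pos, hnorm]; exact hpos
      have hδ : 0 ≤ c * ‖a‖ ^ (-s) := by positivity
      refine (measure_mono ?_).trans ((volume_nearly_parallel_le (fun i => (a i : ℝ)) j haj
        (Nat.cast_nonneg M) hδ).trans (ENNReal.ofReal_le_ofReal ?_))
      · rintro h ⟨-, h1, h2⟩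
        exact ⟨h1, fun i => h2 i j⟩
      · rw [hnorm]
        have hpow : (‖a‖ ^ (-s) / ‖a‖) ^ (K - 1) = ‖a‖ ^ (-(K + ε)) := by
          rw [← Real.rpow_sub_one hpos.ne', ← Real.rpow_natCast, ← Real.rpow_mul hpos.le,
            Nat.cast_sub (by omega), hs]
          congr 1
          push_cast
          field_simp
          ring
        have hck : c ^ (K - 1) ≤ c := pow_le_of_le_one hc0.le hc1 (by omega)
        calc 2 * (M : ℝ) * (2 * (c * ‖a‖ ^ (-s) / ‖a‖)) ^ (K - 1)
            = c ^ (K - 1) * (2 * M * 2 ^ (K - 1) * (‖a‖ ^ (-s) / ‖a‖) ^ (K - 1)) := by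
              rw [mul_div_assoc, mul_pow, mul_pow]; ring
          _ ≤ c * (2 * M * 2 ^ (K - 1) * (‖a‖ ^ (-s) / ‖a‖) ^ (K - 1)) := by gcongr
          _ = c * g a := by rw [hpow]
    have hlim : Filter.Tendsto (fun n : ℕ => ENNReal.ofReal (1 / ((n : ℝ) + 1) * ∑' a, g a))
        Filter.atTop (nhds 0) := by
      have := ENNReal.tendsto_ofReal
        ((tendsto_one_div_add_atTop_nhds_zero_nat (𝕜 := ℝ)).mul_const (∑' a, g a))
      simpa using this
    exact le_antisymm (ge_of_tendsto' hlim hbound) zero_le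
  have hae : ∀ᵐ h : Fin K → ℝ ∂volume, ∀ M, h ∉ B M :=
    ae_all_iff.2 fun M => measure_eq_zero_iff_ae_notMem.1 (hB0 M)
  filter_upwards [hae] with h hh
  obtain ⟨M, hM⟩ := exists_nat_ge ‖h‖
  have h1 := hh M
  simp only [hB, Set.mem_ofPred_eq, not_and, not_forall] at h1
  obtain ⟨n, hn⟩ := h1 fun i => (norm_le_pi_norm h i).trans hM
  push Not at hn
  exact ⟨1 / ((n : ℝ) + 1), Nat.one_div_pos_of_nat, hn⟩

/-- An integer vector is controlled by any real multiple of `h` approximating it. -/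
lemma norm_le_of_effective_noise {K : ℕ} (h : Fin K → ℝ) (a : Fin K → ℤ) (β : ℝ) {S : ℝ}
    (hS : 1 ≤ S) :
    ‖a‖ ≤ (‖h‖ + 1) * √(S * (∑ i, (β * h i - (a i : ℝ)) ^ 2) + β ^ 2) := by
  set D := ∑ i, (β * h i - (a i : ℝ)) ^ 2
  have hD : 0 ≤ D := Finset.sum_nonneg fun i _ => sq_nonneg _
  have hβ : |β| ≤ √(S * D + β ^ 2) := Real.abs_le_sqrt (by nlinarith)
  refine (pi_norm_le_iff_of_nonneg (by positivity)).2 fun i => ?_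
  have hi : |β * h i - a i| ≤ √(S * D + β ^ 2) := by
    refine Real.abs_le_sqrt ?_
    have := Finset.single_le_sum (f := fun i => (β * h i - (a i : ℝ)) ^ 2)
      (fun i _ => sq_nonneg _) (Finset.mem_univ i)
    have h2 : (β * h i - (a i : ℝ)) ^ 2 ≤ D := this
    nlinarith [sq_nonneg β]
  rw [Int.norm_eq_abs]
  have h3 : |(a i : ℝ)| ≤ |β * h i - a i| + |β * h i| := by
    have := abs_sub_le (a i : ℝ) (β * h i) 0
    rw [sub_zero, sub_zero, abs_sub_comm] at this
    exact this
  have h4 : |β * h i| ≤ √(S * D + β ^ 2) * ‖h‖ := by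
    rw [abs_mul]
    exact mul_le_mul hβ (norm_le_pi_norm h i) (abs_nonneg _) (Real.sqrt_nonneg _)
  linarith

lemma abs_wedge_le_of_effective_noise {K : ℕ} (h : Fin K → ℝ) (a : Fin K → ℤ) (β : ℝ) {S : ℝ}
    (hS : 1 ≤ S) (i j : Fin K) :
    |(a j : ℝ) * h i - a i * h j| * √S ≤
      2 * ‖h‖ * √(S * (∑ i, (β * h i - (a i : ℝ)) ^ 2) + β ^ 2) := by
  set D := ∑ i, (β * h i - (a i : ℝ)) ^ 2
  have hk : ∀ k, |β * h k - a k| * √S ≤ √(S * D + β ^ 2) := by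
    intro k
    have := Finset.single_le_sum (f := fun i => (β * h i - (a i : ℝ)) ^ 2)
      (fun i _ => sq_nonneg _) (Finset.mem_univ k)
    have h2 : (β * h k - (a k : ℝ)) ^ 2 ≤ D := this
    refine Real.le_sqrt_of_sq_le ?_
    rw [mul_pow, sq_abs, Real.sq_sqrt (by linarith)]
    nlinarith [sq_nonneg β]
  have h1 : (a j : ℝ) * h i - a i * h j =
      (β * h i - a i) * h j - (β * h j - a j) * h i := by ring
  have hi : |h i| ≤ ‖h‖ := norm_le_pi_norm h i
  have hj : |h j| ≤ ‖h‖ := norm_le_pi_norm h j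
  calc |(a j : ℝ) * h i - a i * h j| * √S
      ≤ (|β * h i - a i| * |h j| + |β * h j - a j| * |h i|) * √S := by
        rw [h1, ← abs_mul, ← abs_mul]
        gcongr
        exact abs_sub _ _
    _ = (|β * h i - a i| * √S) * |h j| + (|β * h j - a j| * √S) * |h i| := by ring
    _ ≤ √(S * D + β ^ 2) * ‖h‖ + √(S * D + β ^ 2) * ‖h‖ := by
        gcongr <;> exact hk _
    _ = _ := by ring

lemma one_le_norm_of_ne_zero {K : ℕ} {a : Fin K → ℤ} (ha : a ≠ 0) : 1 ≤ ‖a‖ := by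
  obtain ⟨i, hi⟩ := Function.ne_iff.1 ha
  refine le_trans ?_ (norm_le_pi_norm a i)
  rw [Int.norm_eq_abs]
  exact_mod_cast Int.one_le_abs hi

/-- For almost every `h`, the effective noise grows at least like `S ^ (1 - 1 / K - ε)`. -/
lemma ae_effective_noise_ge {K : ℕ} (hK : 1 ≤ K) {ε : ℝ} (hε : 0 < ε) :
    ∀ᵐ h : Fin K → ℝ ∂volume, ∃ C : ℝ, 0 < C ∧ ∀ S : ℝ, 1 ≤ S → ∀ a : Fin K → ℤ, a ≠ 0 →
      ∀ β : ℝ, C * S ^ (1 - 1 / (K : ℝ) - ε) ≤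
        S * (∑ i, (β * h i - (a i : ℝ)) ^ 2) + β ^ 2 := by
  have hσ : ∀ (h : Fin K → ℝ) (a : Fin K → ℤ) (S β : ℝ), 1 ≤ S →
      0 ≤ S * (∑ i, (β * h i - (a i : ℝ)) ^ 2) + β ^ 2 := by
    intro h a S β hS
    have : 0 ≤ ∑ i, (β * h i - (a i : ℝ)) ^ 2 := Finset.sum_nonneg fun i _ => sq_nonneg _
    positivity
  rcases hK.eq_or_lt with rfl | hK2
  · refine Filter.Eventually.of_forall fun h =>
      ⟨1 / (‖h‖ + 1) ^ 2, by positivity, fun S hS a ha β => ?_⟩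
    have h1 := (one_le_norm_of_ne_zero ha).trans (norm_le_of_effective_noise h a β hS)
    have hS1 : S ^ (1 - 1 / ((1 : ℕ) : ℝ) - ε) ≤ 1 :=
      Real.rpow_le_one_of_one_le_of_nonpos hS (by norm_num; exact hε.le)
    have h2 := Real.sq_sqrt (hσ h a S β hS)
    set q := √(S * (∑ i, (β * h i - (a i : ℝ)) ^ 2) + β ^ 2)
    rw [← h2]
    calc 1 / (‖h‖ + 1) ^ 2 * S ^ (1 - 1 / ((1 : ℕ) : ℝ) - ε) ≤ 1 / (‖h‖ + 1) ^ 2 * 1 := by gcongr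
      _ ≤ q ^ 2 := by
        rw [mul_one, div_le_iff₀ (by positivity), ← mul_pow]
        exact one_le_pow₀ (by linarith)
  · filter_upwards [ae_exists_lt_abs_wedge hK2 hε] with h ⟨c, hc, hw⟩
    have hKr : (2 : ℝ) ≤ K := by exact_mod_cast hK2
    have hK1 : (0 : ℝ) < K - 1 := by linarith
    set s : ℝ := (1 + ε) / (K - 1) with hs
    have hs0 : 0 < s := by positivity
    set A := ‖h‖ + 1
    have hA : 0 < A := by positivity
    refine ⟨(c / 2) ^ (2 / (1 + s)) / A ^ 2, by positivity, fun S hS a ha β => ?_⟩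
    have h1 := norm_le_of_effective_noise h a β hS
    obtain ⟨i, j, hij⟩ := hw a ha
    have h3 := abs_wedge_le_of_effective_noise h a β hS i j
    have h2 := Real.sq_sqrt (hσ h a S β hS)
    have hN := one_le_norm_of_ne_zero ha
    set q := √(S * (∑ i, (β * h i - (a i : ℝ)) ^ 2) + β ^ 2)
    rw [← h2]
    have hq : 0 < A * q := by linarith
    have hS0 : 0 < S := by linarith
    have hsq : 0 < √S := Real.sqrt_pos.2 hS0
    have hq0 : 0 < q := pos_of_mul_pos_right hq hA.le
    have h4 : (A * q) ^ (-s) ≤ ‖a‖ ^ (-s) :=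
      Real.rpow_le_rpow_of_nonpos (by linarith) h1 (by linarith)
    have h5 : c / 2 * √S ≤ (A * q) ^ (1 + s) := by
      have h6 : c * (A * q) ^ (-s) * √S ≤ 2 * (A * q) :=
        calc c * (A * q) ^ (-s) * √S ≤ c * ‖a‖ ^ (-s) * √S := by gcongr
          _ ≤ |(a j : ℝ) * h i - a i * h j| * √S := by gcongr
          _ ≤ 2 * ‖h‖ * q := h3
          _ ≤ 2 * (A * q) := by nlinarith [show A = ‖h‖ + 1 from rfl]
      have h7 : 0 < (A * q) ^ s := by positivity
      rw [Real.rpow_neg hq.le, ← div_eq_mul_inv, div_mul_eq_mul_div, div_le_iff₀ h7] at h6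
      rw [Real.rpow_add hq, Real.rpow_one]
      linarith
    have h8 : (c / 2 * √S) ^ (2 / (1 + s)) ≤ (A * q) ^ 2 := by
      calc (c / 2 * √S) ^ (2 / (1 + s)) ≤ ((A * q) ^ (1 + s)) ^ (2 / (1 + s)) := by gcongr
        _ = (A * q) ^ 2 := by
          rw [← Real.rpow_mul hq.le, mul_div_cancel₀ _ (by positivity : (1 + s) ≠ 0),
            Real.rpow_two]
    have h9 : √S ^ (2 / (1 + s)) = S ^ (1 / (1 + s)) := by
      rw [Real.sqrt_eq_rpow, ← Real.rpow_mul hS0.le]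
      congr 1
      ring
    rw [Real.mul_rpow (by positivity) hsq.le, h9, mul_pow] at h8
    have h10 : 1 - 1 / (K : ℝ) - ε ≤ 1 / (1 + s) := by
      have hse : 1 + s = (K + ε) / (K - 1) := by
        rw [hs]; field_simp; ring
      have hid : (K - 1) / (K + ε) - (1 - 1 / (K : ℝ) - ε) =
          ε * (K * (K + ε) - (K - 1)) / (K * (K + ε)) := by
        field_simp
        ring
      have : 0 ≤ ε * (K * (K + ε) - (K - 1)) / (K * (K + ε)) := by
        apply div_nonneg _ (by positivity)
        apply mul_nonneg hε.le
        nlinarith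
      rw [hse, one_div_div]
      linarith
    rw [div_mul_eq_mul_div, div_le_iff₀ (by positivity)]
    calc (c / 2) ^ (2 / (1 + s)) * S ^ (1 - 1 / (K : ℝ) - ε)
        ≤ (c / 2) ^ (2 / (1 + s)) * S ^ (1 / (1 + s)) := by gcongr
      _ ≤ _ := by linarith

/-- In `ℝ`, eventual upper bounds up to every `ε` bound the `limsup`, provided the target is
nonnegative; no boundedness of `f` from below is needed. -/
lemma limsup_le_of_forall_eventually_le_add {α : Type*} {l : Filter α} {f : α → ℝ} {x : ℝ}
    (hx : 0 ≤ x) (hf : ∀ n : ℕ, ∀ᶠ t in l, f t ≤ x + 1 / ((n : ℝ) + 1)) :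
    Filter.limsup f l ≤ x := by
  rw [Filter.limsup_eq]
  by_cases hb : BddBelow {y | ∀ᶠ t in l, f t ≤ y}
  · refine le_of_forall_pos_le_add fun δ hδ => ?_
    obtain ⟨n, hn⟩ := exists_nat_one_div_lt hδ
    have := csInf_le hb (hf n)
    linarith
  · rwa [Real.sInf_of_not_bddBelow hb]

/-- For Lebesgue-almost every `h ∈ ℝ^K`, the degrees-of-freedom of the highest
computation rate `R₁(h; SNR) = sup_{a ∈ ℤ^K∖{0}} (1/2)·log₂(SNR/σ²_eff(h,a;SNR))` is at
most `1/K`. -/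
theorem stmt13 (K : ℕ) (hK : 1 ≤ K) :
    ∀ᵐ h : Fin K → ℝ ∂volume,
      Filter.limsup (fun SNR : ℝ =>
          (⨆ a : {a : Fin K → ℤ // a ≠ 0},
              (1 / 2 : ℝ) * Real.logb 2 (SNR /
                (⨅ β : ℝ, SNR * (∑ i, (β * h i - (a.1 i : ℝ)) ^ 2) + β ^ 2)))
            / ((1 / 2 : ℝ) * Real.logb 2 (1 + SNR)))
        Filter.atTop ≤ 1 / K := by
  have hae : ∀ᵐ h : Fin K → ℝ ∂volume, ∀ n : ℕ, ∃ C : ℝ, 0 < C ∧ ∀ S : ℝ, 1 ≤ S →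
      ∀ a : Fin K → ℤ, a ≠ 0 → ∀ β : ℝ,
        C * S ^ (1 - 1 / (K : ℝ) - 1 / ((n : ℝ) + 1) / 2) ≤
          S * (∑ i, (β * h i - (a i : ℝ)) ^ 2) + β ^ 2 :=
    ae_all_iff.2 fun n => ae_effective_noise_ge hK (half_pos Nat.one_div_pos_of_nat)
  filter_upwards [hae] with h hh
  refine limsup_le_of_forall_eventually_le_add (by positivity) fun n => ?_
  obtain ⟨C, hC, hbound⟩ := hh n
  have hε : 0 < 1 / ((n : ℝ) + 1) := Nat.one_div_pos_of_nat
  set ε := 1 / ((n : ℝ) + 1)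
  have hlog : Filter.Tendsto (fun S : ℝ => Real.logb 2 (1 + S)) Filter.atTop Filter.atTop :=
    (Real.tendsto_logb_atTop one_lt_two).comp
      (Filter.tendsto_atTop_add_const_left _ _ Filter.tendsto_id)
  have hlarge := hlog.eventually_ge_atTop (-Real.logb 2 C / (ε / 2))
  filter_upwards [hlarge, Filter.eventually_ge_atTop 1] with S hSC hS
  have hS0 : 0 < S := by linarith
  have hL : 0 < Real.logb 2 (1 + S) := Real.logb_pos one_lt_two (by linarith)
  have : Nonempty {a : Fin K → ℤ // a ≠ 0} :=
    ⟨⟨fun _ => 1, fun h0 => one_ne_zero (congrFun h0 ⟨0, hK⟩)⟩⟩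
  rw [div_le_iff₀ (by positivity)]
  refine ciSup_le fun a => ?_
  have hinf : C * S ^ (1 - 1 / (K : ℝ) - ε / 2) ≤
      ⨅ β : ℝ, S * (∑ i, (β * h i - (a.1 i : ℝ)) ^ 2) + β ^ 2 :=
    le_ciInf fun β => hbound S hS a.1 a.2 β
  set σ := ⨅ β : ℝ, S * (∑ i, (β * h i - (a.1 i : ℝ)) ^ 2) + β ^ 2
  have hCS : 0 < C * S ^ (1 - 1 / (K : ℝ) - ε / 2) := by positivity
  have h1 : Real.logb 2 (C * S ^ (1 - 1 / (K : ℝ) - ε / 2)) ≤ Real.logb 2 σ :=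
    Real.logb_le_logb_of_le one_lt_two hCS hinf
  rw [Real.logb_mul hC.ne' (by positivity), Real.logb_rpow_eq_mul_logb_of_pos hS0] at h1
  have h2 : Real.logb 2 S ≤ Real.logb 2 (1 + S) :=
    Real.logb_le_logb_of_le one_lt_two hS0 (by linarith)
  rw [Real.logb_div hS0.ne' (hCS.trans_le hinf).ne']
  rw [div_le_iff₀ (by positivity)] at hSC
  have hp : 0 ≤ 1 / (K : ℝ) + ε / 2 := by positivity
  nlinarith [mul_le_mul_of_nonneg_left h2 hp]
end

section
/- Let K ≥ 1 be an integer. For m = 1, …, K and h ∈ ℝ^K, SNR > 0, define the m-th optimal computation rate R_m(h; SNR) := sup over all families a₁, …, a_m ∈ ℤ^K that are linearly independent over ℝ of min_{1 ≤ i ≤ m} (1/2)·log₂(SNR / σ²_eff(h, aᵢ; SNR)). Then for Lebesgue-almost every h ∈ ℝ^K and every m ∈ {1, …, K}, R_m(h; SNR) / ((1/2)·log₂(1 + SNR)) → 1/K as SNR → ∞. -/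
open Finset MeasureTheory

/-- The linear map that keeps the `k`-th coordinate and replaces every other coordinate `x i` by
`s * x i - t i * x k`. -/
noncomputable def shear {ι : Type*} [DecidableEq ι] (k : ι) (s : ℝ) (t : ι → ℝ) :
    (ι → ℝ) →ₗ[ℝ] (ι → ℝ) where
  toFun x := fun i => if i = k then x k else s * x i - t i * x k
  map_add' x y := by
    ext i
    by_cases hi : i = k
    · simp [hi]
    · simp [hi]; ring
  map_smul' c x := by
    ext i
    by_cases hi : i = k
    · simp [hi]
    · simp [hi]; ring

theorem shear_apply_self {ι : Type*} [DecidableEq ι] (k : ι) (s : ℝ) (t x : ι → ℝ) :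
    shear k s t x k = x k := by
  simp [shear]

theorem shear_apply_of_ne {ι : Type*} [DecidableEq ι] {k i : ι} (hi : i ≠ k) (s : ℝ)
    (t x : ι → ℝ) : shear k s t x i = s * x i - t i * x k := by
  simp [shear, hi]

theorem det_shear {ι : Type*} [Fintype ι] [DecidableEq ι] (k : ι) {s : ℝ} (hs : s ≠ 0)
    (t : ι → ℝ) : LinearMap.det (shear k s t) = s ^ (Fintype.card ι - 1) := by
  have h : shear k s t =
      Matrix.toLin' (Matrix.diagonal (fun i => if i = k then 1 else s)) ∘ₗ
        LinearMap.transvection (LinearMap.proj k) (fun i => if i = k then 0 else -(t i / s)) := by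
    refine LinearMap.ext fun x => funext fun i => ?_
    by_cases hi : i = k
    · subst hi
      simp [shear_apply_self, Matrix.mulVec_diagonal, LinearMap.transvection.apply]
    · simp [shear_apply_of_ne hi, Matrix.mulVec_diagonal, LinearMap.transvection.apply, hi]
      field_simp
      ring
  rw [h, LinearMap.det_comp, LinearMap.transvection.det, LinearMap.det_toLin', Matrix.det_diagonal,
    Finset.prod_ite]
  simp [Finset.filter_ne', Finset.card_erase_of_mem]

theorem norm_intCast_pi {ι : Type*} [Fintype ι] (a : ι → ℤ) :
    ‖fun j => (a j : ℝ)‖ = ‖a‖ := by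
  rfl

theorem summable_norm_rpow_pi_int {ι : Type*} [Fintype ι] {r : ℝ} (hr : r < -Fintype.card ι) :
    Summable fun a : ι → ℤ => ‖a‖ ^ r := by
  let b := Pi.basisFun ℝ ι
  let L := Submodule.span ℤ (Set.range b)
  have hL : Module.finrank ℤ L = Fintype.card ι := by
    rw [ZLattice.rank ℝ L, Module.finrank_pi]
  have hs := ZLattice.summable_norm_rpow L r (by rwa [hL])
  let φ : (ι → ℤ) → L := fun a => ⟨fun j => (a j : ℝ), by
    refine (b.mem_span_iff_repr_mem ℤ _).2 fun i => ⟨a i, ?_⟩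
    simp [b]⟩
  have hφ : Function.Injective φ := fun a a' h => by
    funext j
    have : (a j : ℝ) = a' j := congrFun (congrArg Subtype.val h) j
    exact_mod_cast this
  refine (hs.comp_injective hφ).congr fun a => ?_
  change ‖fun j => (a j : ℝ)‖ ^ r = _
  rw [norm_intCast_pi]

/-- The maximal size of the minors of the two-row matrix with rows `a` and `h`. -/
noncomputable def minorNorm {ι : Type*} [Fintype ι] (a : ι → ℤ) (h : ι → ℝ) : ℝ :=
  ‖fun p : ι × ι => (a p.1 : ℝ) * h p.2 - a p.2 * h p.1‖

theorem minorNorm_nsmul {ι : Type*} [Fintype ι] (n : ℕ) (a : ι → ℤ) (h : ι → ℝ) :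
    minorNorm (n • a) h = n * minorNorm a h := by
  have : (fun p : ι × ι => ((n • a) p.1 : ℝ) * h p.2 - (n • a) p.2 * h p.1) =
      (n : ℝ) • fun p : ι × ι => (a p.1 : ℝ) * h p.2 - a p.2 * h p.1 := by
    funext p
    simp
    ring
  rw [minorNorm, this, norm_smul, minorNorm]
  simp

theorem exists_abs_eq_norm {ι : Type*} [Fintype ι] [Nonempty ι] (a : ι → ℤ) :
    ∃ k, |(a k : ℝ)| = ‖a‖ := by
  obtain ⟨k, -, hk⟩ := Finset.exists_max_image Finset.univ (fun i => ‖a i‖) Finset.univ_nonempty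
  refine ⟨k, ?_⟩
  rw [← Int.norm_eq_abs]
  exact le_antisymm (norm_le_pi_norm a k)
    ((pi_norm_le_iff_of_nonneg (norm_nonneg _)).2 fun i => hk i (Finset.mem_univ i))

theorem volume_minorNorm_le {ι : Type*} [Fintype ι] [Nonempty ι] {a : ι → ℤ} (ha : a ≠ 0)
    (R : ℝ) {δ : ℝ} (hδ : 0 ≤ δ) :
    volume {h : ι → ℝ | ‖h‖ ≤ R ∧ minorNorm a h ≤ δ} ≤
      ENNReal.ofReal (2 * R * (2 * δ / ‖a‖) ^ (Fintype.card ι - 1)) := by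
  classical
  by_cases hR : 0 ≤ R
  swap
  · have : {h : ι → ℝ | ‖h‖ ≤ R ∧ minorNorm a h ≤ δ} = ∅ := by
      ext h
      simp only [Set.mem_ofPred_eq, Set.mem_empty_iff_false, iff_false]
      exact fun hh => hR ((norm_nonneg _).trans hh.1)
    simp [this]
  obtain ⟨k, hk⟩ := exists_abs_eq_norm a
  have ha' : 0 < ‖a‖ := norm_pos_iff.2 ha
  have hak : (a k : ℝ) ≠ 0 := fun h0 => by rw [h0, abs_zero] at hk; exact ha'.ne hk
  have hdet := det_shear k hak (fun i => (a i : ℝ))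
  let r : ι → ℝ := fun i => if i = k then R else δ
  have hsub : {h : ι → ℝ | ‖h‖ ≤ R ∧ minorNorm a h ≤ δ} ⊆
      shear k (a k : ℝ) (fun i => (a i : ℝ)) ⁻¹'
        Set.pi Set.univ (fun i => Set.Icc (-r i) (r i)) := by
    rintro h ⟨h1, h2⟩
    simp only [Set.mem_preimage, Set.mem_pi, Set.mem_univ, true_imp_iff, Set.mem_Icc, ← abs_le]
    intro i
    by_cases hi : i = k
    · subst hi
      rw [shear_apply_self]
      simpa [r] using (norm_le_pi_norm h i).trans h1
    · rw [shear_apply_of_ne hi]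
      simpa [r, hi] using (norm_le_pi_norm
        (fun p : ι × ι => (a p.1 : ℝ) * h p.2 - a p.2 * h p.1) (k, i)).trans h2
  refine (measure_mono hsub).trans ?_
  rw [Measure.addHaar_preimage_linearMap _ (by rw [hdet]; positivity), hdet, volume_pi,
    Measure.pi_pi]
  simp only [Real.volume_Icc]
  have hr : ∀ i, 0 ≤ r i - -r i := fun i => by
    by_cases hi : i = k <;> simp [r, hi] <;> linarith
  rw [← ENNReal.ofReal_prod_of_nonneg fun i _ => hr i, ← ENNReal.ofReal_mul (abs_nonneg _)]
  refine ENNReal.ofReal_le_ofReal (le_of_eq ?_)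
  have hprod : ∏ i, (r i - -r i) = 2 * R * (2 * δ) ^ (Fintype.card ι - 1) := by
    rw [← Finset.mul_prod_erase _ _ (Finset.mem_univ k)]
    rw [Finset.prod_congr rfl (g := fun _ => 2 * δ) fun i hi => by
      simp [r, (Finset.mem_erase.1 hi).1]; ring]
    simp [r, Finset.card_erase_of_mem]
    left; ring
  rw [hprod, abs_inv, abs_pow, hk, div_pow]
  field_simp

theorem ae_finite_minorNorm_le {ι : Type*} [Fintype ι] [Nonempty ι] {τ : ℝ}
    (hτ : 1 < τ * (Fintype.card ι - 1 : ℕ)) (R : ℝ) :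
    ∀ᵐ h : ι → ℝ, ‖h‖ ≤ R → {a : ι → ℤ | a ≠ 0 ∧ minorNorm a h ≤ ‖a‖ ^ (-τ)}.Finite := by
  let s : (ι → ℤ) → Set (ι → ℝ) := fun a => {h | a ≠ 0 ∧ ‖h‖ ≤ R ∧ minorNorm a h ≤ ‖a‖ ^ (-τ)}
  have hcard : (Fintype.card ι : ℝ) = (Fintype.card ι - 1 : ℕ) + 1 := by
    have := Fintype.card_pos (α := ι)
    rw [Nat.cast_sub this]; simp
  set d := Fintype.card ι - 1
  have hsum : Summable fun a : ι → ℤ => 2 * |R| * 2 ^ d * ‖a‖ ^ (-(1 + τ) * d) := by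
    refine (summable_norm_rpow_pi_int ?_).mul_left _
    rw [hcard]
    linarith
  have hle : ∀ a, volume (s a) ≤ ENNReal.ofReal (2 * |R| * 2 ^ d * ‖a‖ ^ (-(1 + τ) * d)) := by
    intro a
    by_cases ha : a = 0
    · simp [s, ha]
    have ha' : 0 < ‖a‖ := norm_pos_iff.2 ha
    have : s a ⊆ {h : ι → ℝ | ‖h‖ ≤ |R| ∧ minorNorm a h ≤ ‖a‖ ^ (-τ)} :=
      fun h hh => ⟨hh.2.1.trans (le_abs_self R), hh.2.2⟩
    refine (measure_mono this).trans
      ((volume_minorNorm_le ha |R| (by positivity)).trans (ENNReal.ofReal_le_ofReal (le_of_eq ?_)))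
    have e : ‖a‖ ^ (-τ) / ‖a‖ = ‖a‖ ^ (-(1 + τ)) := by
      rw [← Real.rpow_sub_one ha'.ne']; congr 1; ring
    rw [mul_div_assoc, e, mul_pow, Real.rpow_mul_natCast ha'.le]
    ring
  have hfin : ∑' a, volume (s a) ≠ ⊤ := by
    refine ne_top_of_le_ne_top ?_ (ENNReal.tsum_le_tsum hle)
    rw [← ENNReal.ofReal_tsum_of_nonneg (fun a => by positivity) hsum]
    exact ENNReal.ofReal_ne_top
  filter_upwards [ae_finite_setOfPred_mem hfin] with h hh hR
  exact hh.subset fun a ha => ⟨ha.1, hR, ha.2⟩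

/-- Almost every direction is badly approximable by integer vectors, up to an arbitrarily small
loss in the exponent. -/
theorem ae_exists_forall_le_minorNorm {ι : Type*} [Fintype ι] [Nonempty ι] {τ : ℝ}
    (hτ : 1 < τ * (Fintype.card ι - 1 : ℕ)) :
    ∀ᵐ h : ι → ℝ, ∃ c > 0, ∀ a : ι → ℤ, a ≠ 0 → c * ‖a‖ ^ (-τ) ≤ minorNorm a h := by
  filter_upwards [ae_all_iff.2 fun N : ℕ => ae_finite_minorNorm_le hτ (N : ℝ)] with h hh
  obtain ⟨N, hN⟩ := exists_nat_ge ‖h‖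
  have hfin := hh N hN
  have hpos : ∀ a : ι → ℤ, a ≠ 0 → 0 < minorNorm a h := by
    intro a ha
    refine (norm_nonneg _).lt_of_ne' fun h0 => ?_
    have hinj : Function.Injective fun n : ℕ => (n + 1) • a := fun n m hnm => by
      obtain ⟨i, hi⟩ := Function.ne_iff.1 ha
      have := congrFun hnm i
      simp only [Pi.smul_apply, nsmul_eq_mul] at this
      have := mul_right_cancel₀ hi this
      push_cast at this
      omega
    refine Set.infinite_range_of_injective hinj (hfin.subset ?_)
    rintro _ ⟨n, rfl⟩
    refine ⟨smul_ne_zero (Nat.succ_ne_zero n) ha, ?_⟩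
    change minorNorm a h = 0 at h0
    simp only
    rw [minorNorm_nsmul, h0, mul_zero]
    positivity
  obtain ⟨c, hc, hcF⟩ : ∃ c > 0, ∀ a ∈ {a : ι → ℤ | a ≠ 0 ∧ minorNorm a h ≤ ‖a‖ ^ (-τ)},
      c ≤ minorNorm a h / ‖a‖ ^ (-τ) := by
    rcases Set.eq_empty_or_nonempty {a : ι → ℤ | a ≠ 0 ∧ minorNorm a h ≤ ‖a‖ ^ (-τ)} with he | hne
    · exact ⟨1, one_pos, by simp [he]⟩
    · obtain ⟨b, hb, hmin⟩ := Set.exists_min_image _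
        (fun a => minorNorm a h / ‖a‖ ^ (-τ)) hfin hne
      exact ⟨_, div_pos (hpos b hb.1) (Real.rpow_pos_of_pos (norm_pos_iff.2 hb.1) _), hmin⟩
  refine ⟨min c 1, lt_min hc one_pos, fun a ha => ?_⟩
  have hpa : 0 < ‖a‖ ^ (-τ) := Real.rpow_pos_of_pos (norm_pos_iff.2 ha) _
  by_cases hm : minorNorm a h ≤ ‖a‖ ^ (-τ)
  · exact (mul_le_mul_of_nonneg_right (min_le_left _ _) hpa.le).trans
      ((le_div_iff₀ hpa).1 (hcF a ⟨ha, hm⟩))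
  · calc min c 1 * ‖a‖ ^ (-τ) ≤ 1 * ‖a‖ ^ (-τ) :=
          mul_le_mul_of_nonneg_right (min_le_right _ _) hpa.le
      _ ≤ _ := by linarith

theorem exists_intCast_mem_of_lt_volume {ι : Type*} [Fintype ι] {s : Set (ι → ℝ)}
    (h_symm : ∀ x ∈ s, -x ∈ s) (h_conv : Convex ℝ s) (h : 2 ^ Fintype.card ι < volume s) :
    ∃ a : ι → ℤ, a ≠ 0 ∧ (fun j => (a j : ℝ)) ∈ s := by
  classical
  let b := Pi.basisFun ℝ ι
  have fund := ZSpan.isAddFundamentalDomain' b volume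
  have : Countable (Submodule.span ℤ (Set.range b)).toAddSubgroup :=
    inferInstanceAs (Countable (Submodule.span ℤ (Set.range b)))
  have hvol : volume (ZSpan.fundamentalDomain b) = 1 := by
    rw [ZSpan.fundamentalDomain_pi_basisFun, volume_pi_pi]
    simp
  obtain ⟨x, hx0, hxs⟩ := exists_ne_zero_mem_lattice_of_measure_mul_two_pow_lt_measure fund
    h_symm h_conv (by rwa [hvol, one_mul, Module.finrank_pi])
  have hx := (b.mem_span_iff_repr_mem ℤ (x : ι → ℝ)).1 x.2
  choose a ha using hx
  have hax : (fun j => (a j : ℝ)) = x := by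
    funext j
    simpa [b] using ha j
  refine ⟨a, ?_, hax ▸ hxs⟩
  rintro rfl
  apply hx0
  ext1
  rw [← hax]
  ext1
  simp

/-- If every nonzero vector of the lattice `M ℤ^ι` is long, then the lattice contains a full set
of linearly independent vectors that are not too long. -/
theorem exists_linearIndependent_norm_le {ι : Type*} [Fintype ι] [Nonempty ι]
    (M : (ι → ℝ) →ₗ[ℝ] (ι → ℝ)) (hM : LinearMap.det M ≠ 0) {L ρ : ℝ} (hL : 0 < L) (hρ : 0 < ρ)
    (hmin : ∀ a : ι → ℤ, a ≠ 0 → Fintype.card ι * L < ‖M fun j => (a j : ℝ)‖)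
    (hvol : |LinearMap.det M| < L ^ (Fintype.card ι - 1) * ρ) :
    ∃ a : Fin (Fintype.card ι) → ι → ℤ,
      LinearIndependent ℝ (fun i => fun j => (a i j : ℝ)) ∧
        ∀ i, ‖M fun j => (a i j : ℝ)‖ ≤ ρ + Fintype.card ι * L := by
  classical
  let A : Set (ι → ℝ) := {x | ∃ a : ι → ℤ, x = (fun j => (a j : ℝ)) ∧
    ‖M x‖ ≤ ρ + Fintype.card ι * L}
  have hspan : Submodule.span ℝ A = ⊤ := by
    by_contra hne
    obtain ⟨f, hf0, hf⟩ := Submodule.exists_le_ker_of_lt_top _ (lt_top_iff_ne_top.2 hne)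
    let e := M.equivOfDetNeZero hM
    have heM : ∀ x, e x = M x := fun x => rfl
    let g₀ : (ι → ℝ) →ₗ[ℝ] ℝ := f ∘ₗ e.symm.toLinearMap
    have hg₀ : ∀ x, g₀ (M x) = f x := fun x => by simp [g₀, ← heM]
    obtain ⟨k, -, hk⟩ := Finset.exists_max_image Finset.univ
      (fun i => |g₀ (Pi.single i 1)|) Finset.univ_nonempty
    have hsum₀ : ∀ y, g₀ y = ∑ i, y i * g₀ (Pi.single i 1) := fun y => by
      rw [LinearMap.pi_apply_eq_sum_univ g₀ y]
      refine Finset.sum_congr rfl fun i _ => ?_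
      rw [smul_eq_mul]
      congr 2
      ext j
      simp [Pi.single_apply, eq_comm]
    have hgk : g₀ (Pi.single k 1) ≠ 0 := by
      intro h0
      apply hf0
      refine LinearMap.ext fun x => ?_
      rw [← hg₀, hsum₀, LinearMap.zero_apply]
      refine Finset.sum_eq_zero fun i _ => ?_
      have := hk i (Finset.mem_univ i)
      rw [h0, abs_zero] at this
      rw [abs_nonpos_iff.1 this, mul_zero]
    let g : (ι → ℝ) →ₗ[ℝ] ℝ := (g₀ (Pi.single k 1))⁻¹ • g₀
    have hgk1 : g (Pi.single k 1) = 1 := by simp [g, hgk]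
    have hgle : ∀ i, |g (Pi.single i 1)| ≤ 1 := fun i => by
      simp only [g, LinearMap.smul_apply, smul_eq_mul, abs_mul, abs_inv]
      rw [inv_mul_le_one₀ (abs_pos.2 hgk)]
      exact hk i (Finset.mem_univ i)
    have hsum : ∀ y, g y = y k + ∑ i ∈ Finset.univ.erase k, y i * g (Pi.single i 1) := fun y => by
      have : g y = ∑ i, y i * g (Pi.single i 1) := by
        simp only [g, LinearMap.smul_apply, smul_eq_mul]
        rw [hsum₀ y, Finset.mul_sum]
        exact Finset.sum_congr rfl fun i _ => by ring
      rw [this, ← Finset.add_sum_erase _ _ (Finset.mem_univ k), hgk1, mul_one]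
    let N : (ι → ℝ) →ₗ[ℝ] (ι → ℝ) :=
      LinearMap.transvection (g - LinearMap.proj k) (Pi.single k 1)
    have hNk : ∀ y, N y k = g y := fun y => by simp [N, LinearMap.transvection.apply]
    have hNi : ∀ y, ∀ i ≠ k, N y i = y i := fun y i hi => by
      simp [N, LinearMap.transvection.apply, hi]
    have hdetN : LinearMap.det N = 1 := by
      simp [N, LinearMap.transvection.det, hgk1]
    have hdet : LinearMap.det (N ∘ₗ M) = LinearMap.det M := by
      rw [LinearMap.det_comp, hdetN, one_mul]
    let r : ι → ℝ := fun i => if i = k then ρ else L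
    have hr : ∀ i, 0 ≤ r i := fun i => by
      by_cases hi : i = k <;> simp [r, hi, hL.le, hρ.le]
    let s : Set (ι → ℝ) := (N ∘ₗ M) ⁻¹' Set.pi Set.univ fun i => Set.Icc (-r i) (r i)
    have hmem : ∀ x, x ∈ s ↔ ∀ i, |N (M x) i| ≤ r i := fun x => by
      simp only [s, abs_le, Set.mem_preimage, Set.mem_pi, Set.mem_univ, true_imp_iff, Set.mem_Icc,
        LinearMap.comp_apply]
    have hs_vol : 2 ^ Fintype.card ι < volume s := by
      rw [Measure.addHaar_preimage_linearMap _ (by rwa [hdet]), hdet, volume_pi, Measure.pi_pi]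
      simp only [Real.volume_Icc]
      rw [← ENNReal.ofReal_prod_of_nonneg fun i _ => by linarith [hr i],
        ← ENNReal.ofReal_mul (abs_nonneg _)]
      have hprod : ∏ i, (r i - -r i) = 2 ^ Fintype.card ι * (L ^ (Fintype.card ι - 1) * ρ) := by
        have : ∀ i, r i - -r i = 2 * r i := fun i => by ring
        simp only [this]
        have hL' : ∏ i ∈ Finset.univ.erase k, r i = L ^ (Fintype.card ι - 1) := by
          rw [Finset.prod_congr rfl (g := fun _ => L) fun i hi => by
            simp [r, (Finset.mem_erase.1 hi).1]]
          simp [Finset.card_erase_of_mem]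
        rw [Finset.prod_mul_distrib, ← Finset.mul_prod_erase _ r (Finset.mem_univ k), hL']
        simp [r, mul_comm]
      rw [hprod, show (2 : ENNReal) ^ Fintype.card ι = ENNReal.ofReal (2 ^ Fintype.card ι) by
        rw [ENNReal.ofReal_pow (by norm_num)]; norm_num]
      rw [ENNReal.ofReal_lt_ofReal_iff_of_nonneg (by positivity), abs_inv,
        lt_inv_mul_iff₀ (abs_pos.2 hM)]
      rw [mul_comm]
      gcongr
    have hs_symm : ∀ x ∈ s, -x ∈ s := fun x hx => by
      rw [hmem] at hx ⊢
      simpa using hx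
    have hs_conv : Convex ℝ s :=
      (convex_pi fun i _ => convex_Icc _ _).linear_preimage _
    obtain ⟨a, ha0, has⟩ := exists_intCast_mem_of_lt_volume hs_symm hs_conv hs_vol
    rw [hmem] at has
    set y := M fun j => (a j : ℝ) with hy
    have hyi : ∀ i ≠ k, |y i| ≤ L := fun i hi => by
      simpa [hNi y i hi, r, hi] using has i
    have hgy : |g y| ≤ ρ := by simpa [hNk, r] using has k
    have hcard : (Fintype.card ι : ℝ) = (Fintype.card ι - 1 : ℕ) + 1 := by
      rw [Nat.cast_sub Fintype.card_pos]; simp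
    have hrest : |∑ i ∈ Finset.univ.erase k, y i * g (Pi.single i 1)| ≤
        (Fintype.card ι - 1 : ℕ) * L := by
      refine (Finset.abs_sum_le_sum_abs _ _).trans ?_
      rw [← nsmul_eq_mul]
      refine (Finset.sum_le_card_nsmul _ _ L fun i hi => ?_).trans_eq (by
        rw [Finset.card_erase_of_mem (Finset.mem_univ k), Finset.card_univ])
      rw [abs_mul]
      exact (mul_le_of_le_one_right (abs_nonneg _) (hgle i)).trans
        (hyi i (Finset.mem_erase.1 hi).1)
    have hLd : 0 ≤ ((Fintype.card ι - 1 : ℕ) : ℝ) * L := by positivity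
    have bound : ∀ B, 0 ≤ B → |y k| ≤ B + (Fintype.card ι - 1 : ℕ) * L →
        ‖y‖ ≤ B + Fintype.card ι * L := fun B hB hyk => by
      refine (pi_norm_le_iff_of_nonneg (by positivity)).2 fun i => ?_
      rw [Real.norm_eq_abs, hcard]
      by_cases hi : i = k
      · rw [hi]; linarith
      · linarith [hyi i hi]
    have h1 : ‖y‖ ≤ ρ + Fintype.card ι * L := by
      refine bound ρ hρ.le ?_
      rw [show y k = g y - ∑ i ∈ Finset.univ.erase k, y i * g (Pi.single i 1) by
        rw [hsum y]; ring]
      exact (abs_sub _ _).trans (add_le_add hgy hrest)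
    have hf1 : f (fun j => (a j : ℝ)) = 0 := hf (Submodule.subset_span ⟨a, rfl, h1⟩)
    have hg1 : g y = 0 := by simp [g, hy, hg₀, hf1]
    have h2 : ‖y‖ ≤ 0 + Fintype.card ι * L := by
      refine bound 0 le_rfl ?_
      rw [show y k = - ∑ i ∈ Finset.univ.erase k, y i * g (Pi.single i 1) by
        rw [hsum y] at hg1; linarith, abs_neg]
      linarith
    linarith [hmin a ha0]
  obtain ⟨v, hv, -, hli⟩ := Submodule.exists_fun_fin_finrank_span_eq ℝ A
  have hcard : Fintype.card ι = Module.finrank ℝ (Submodule.span ℝ A) := by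
    rw [hspan, finrank_top, Module.finrank_pi]
  choose a ha hle using hv
  refine ⟨fun i => a (Fin.cast hcard i), ?_, fun i => ?_⟩
  · have := hli.comp _ (Fin.cast_injective hcard)
    rwa [show v ∘ Fin.cast hcard = fun i j => (a (Fin.cast hcard i) j : ℝ) from
      funext fun i => ha _] at this
  · rw [← ha]
    exact hle _

theorem norm_le_and_minorNorm_le {ι : Type*} [Fintype ι] {h : ι → ℝ} {S v β : ℝ} (hS : 1 ≤ S)
    {a : ι → ℤ} (hv : S * (∑ j, (β * h j - (a j : ℝ)) ^ 2) + β ^ 2 ≤ v ^ 2) (hv0 : 0 ≤ v) :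
    ‖a‖ ≤ (‖h‖ + 1) * v ∧ minorNorm a h ≤ 2 * ‖h‖ * (v / √S) := by
  have hS0 : 0 < S := one_pos.trans_le hS
  have hsq : 0 < √S := Real.sqrt_pos.2 hS0
  have hsum : 0 ≤ ∑ j, (β * h j - (a j : ℝ)) ^ 2 := Finset.sum_nonneg fun _ _ => sq_nonneg _
  have hβ : |β| ≤ v := abs_le_of_sq_le_sq (by nlinarith) hv0
  have hu : ∀ j, |β * h j - a j| ≤ v / √S := fun j => by
    refine abs_le_of_sq_le_sq ?_ (by positivity)
    rw [div_pow, Real.sq_sqrt hS0.le, le_div_iff₀ hS0]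
    have := Finset.single_le_sum (f := fun j => (β * h j - (a j : ℝ)) ^ 2)
      (fun _ _ => sq_nonneg _) (Finset.mem_univ j)
    nlinarith [sq_nonneg β]
  have hh : ∀ j, |h j| ≤ ‖h‖ := fun j => norm_le_pi_norm h j
  constructor
  · refine (pi_norm_le_iff_of_nonneg (by positivity)).2 fun j => ?_
    rw [Int.norm_eq_abs]
    have h1 : |(a j : ℝ)| ≤ |β * h j| + |β * h j - a j| := by
      have := abs_sub (β * h j) (β * h j - a j)
      rwa [sub_sub_cancel] at this
    have h2 : |β * h j| ≤ v * ‖h‖ := by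
      rw [abs_mul]
      exact mul_le_mul hβ (hh j) (abs_nonneg _) hv0
    have h3 : v / √S ≤ v := div_le_self hv0 (Real.one_le_sqrt.2 hS)
    linarith [hu j]
  · refine (pi_norm_le_iff_of_nonneg (by positivity)).2 fun p => ?_
    rw [Real.norm_eq_abs, show (a p.1 : ℝ) * h p.2 - a p.2 * h p.1 =
      (β * h p.2 - a p.2) * h p.1 - (β * h p.1 - a p.1) * h p.2 by ring]
    refine (abs_sub _ _).trans ?_
    rw [abs_mul, abs_mul]
    have h1 := mul_le_mul (hu p.2) (hh p.1) (abs_nonneg _) (by positivity)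
    have h2 := mul_le_mul (hu p.1) (hh p.2) (abs_nonneg _) (by positivity)
    linarith

theorem ae_exists_forall_le_noise {ι : Type*} [Fintype ι] [Nonempty ι] {γ : ℝ}
    (hγ : γ < 1 - 1 / Fintype.card ι) :
    ∀ᵐ h : ι → ℝ, ∃ c > 0, ∀ S : ℝ, 1 ≤ S → ∀ a : ι → ℤ, a ≠ 0 → ∀ β : ℝ,
      c * S ^ γ ≤ S * (∑ j, (β * h j - (a j : ℝ)) ^ 2) + β ^ 2 := by
  have hnonneg : ∀ (h : ι → ℝ) (S : ℝ), 1 ≤ S → ∀ (a : ι → ℤ) (β : ℝ),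
      0 ≤ S * (∑ j, (β * h j - (a j : ℝ)) ^ 2) + β ^ 2 := fun h S hS a β =>
    add_nonneg (mul_nonneg (by linarith) (Finset.sum_nonneg fun _ _ => sq_nonneg _)) (sq_nonneg _)
  rcases le_or_gt γ 0 with hγ0 | hγ0
  · refine Filter.Eventually.of_forall fun h => ⟨1 / (‖h‖ + 1) ^ 2, by positivity, ?_⟩
    intro S hS a ha β
    have h0 := hnonneg h S hS a β
    set v := S * (∑ j, (β * h j - (a j : ℝ)) ^ 2) + β ^ 2 with hv
    have h1 := (norm_le_and_minorNorm_le (v := √v) hS (Real.sq_sqrt h0).ge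
      (Real.sqrt_nonneg v)).1
    have h2 : 1 ≤ ‖a‖ := by
      obtain ⟨i, hi⟩ := Function.ne_iff.1 ha
      refine le_trans ?_ (norm_le_pi_norm a i)
      rw [Int.norm_eq_abs]
      exact_mod_cast Int.one_le_abs hi
    have h3 : 1 ≤ (‖h‖ + 1) ^ 2 * v := by
      calc (1 : ℝ) ≤ ((‖h‖ + 1) * √v) ^ 2 := one_le_pow₀ (h2.trans h1)
        _ = _ := by rw [mul_pow, Real.sq_sqrt h0]
    calc 1 / (‖h‖ + 1) ^ 2 * S ^ γ ≤ 1 / (‖h‖ + 1) ^ 2 * 1 := by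
          gcongr
          exact Real.rpow_le_one_of_one_le_of_nonpos hS hγ0
      _ ≤ v := by
          rw [mul_one, div_le_iff₀ (by positivity), mul_comm]
          exact h3
  · have hd : (Fintype.card ι : ℝ) = (Fintype.card ι - 1 : ℕ) + 1 := by
      rw [Nat.cast_sub Fintype.card_pos]; simp
    have hτ : 1 < (1 / γ - 1) * (Fintype.card ι - 1 : ℕ) := by
      rw [hd] at hγ
      set d : ℝ := ((Fintype.card ι - 1 : ℕ) : ℝ)
      have hd0 : 0 ≤ d := Nat.cast_nonneg _
      rw [one_sub_div (by positivity), lt_div_iff₀ (by positivity)] at hγ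
      rw [div_sub_one hγ0.ne', div_mul_eq_mul_div, lt_div_iff₀ hγ0]
      linarith
    filter_upwards [ae_exists_forall_le_minorNorm hτ] with h ⟨c, hc, hmin⟩
    set τ := 1 / γ - 1 with hτdef
    have hτγ : 1 + τ = 1 / γ := by rw [hτdef]; ring
    have hγ1 : γ < 1 := hγ.trans_le (by simp)
    have hτ0 : 0 < τ := by
      rw [hτdef, sub_pos]
      exact one_lt_one_div hγ0 hγ1
    set M := ‖h‖ + 1 with hM
    have hM0 : 0 < M := by positivity
    let c₁ := c / (2 * M) / M ^ τ
    have hc₁ : 0 < c₁ := by positivity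
    refine ⟨(c₁ ^ γ) ^ 2, by positivity, fun S hS a ha β => ?_⟩
    have hS0 : 0 < S := one_pos.trans_le hS
    have h0 := hnonneg h S hS a β
    set v := S * (∑ j, (β * h j - (a j : ℝ)) ^ 2) + β ^ 2 with hv
    obtain ⟨h1, h2⟩ := norm_le_and_minorNorm_le (v := √v) hS (Real.sq_sqrt h0).ge
      (Real.sqrt_nonneg v)
    have ha0 : 0 < ‖a‖ := norm_pos_iff.2 ha
    have hv0 : 0 < √v := (Real.sqrt_nonneg v).lt_of_ne' fun h => by
      rw [h, mul_zero] at h1; linarith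
    have hsq : 0 < √S := Real.sqrt_pos.2 hS0
    have h3 : c * (M * √v) ^ (-τ) ≤ 2 * M * (√v / √S) := by
      calc c * (M * √v) ^ (-τ) ≤ c * ‖a‖ ^ (-τ) := by
            have := Real.rpow_le_rpow_of_nonpos ha0 h1 (by linarith : -τ ≤ 0)
            gcongr
        _ ≤ minorNorm a h := hmin a ha
        _ ≤ 2 * ‖h‖ * (√v / √S) := h2
        _ ≤ _ := by gcongr; linarith
    have h4 : c₁ * √S ≤ √v ^ (1 / γ) := by
      rw [← hτγ, Real.rpow_add hv0, Real.rpow_one]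
      rw [Real.rpow_neg (by positivity), Real.mul_rpow hM0.le hv0.le] at h3
      have hp : 0 < √v ^ τ := by positivity
      have hq : 0 < M ^ τ := by positivity
      rw [← div_eq_mul_inv, div_le_iff₀ (by positivity), mul_div_assoc', div_mul_eq_mul_div,
        le_div_iff₀ hsq] at h3
      simp only [c₁]
      rw [div_div, div_mul_eq_mul_div, div_le_iff₀ (by positivity)]
      linarith
    have h5 : c₁ ^ γ * √S ^ γ ≤ √v := by
      rw [← Real.mul_rpow hc₁.le hsq.le]
      refine (Real.rpow_le_rpow (by positivity) h4 hγ0.le).trans_eq ?_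
      rw [← Real.rpow_mul hv0.le, one_div_mul_cancel hγ0.ne', Real.rpow_one]
    calc (c₁ ^ γ) ^ 2 * S ^ γ = (c₁ ^ γ * √S ^ γ) ^ 2 := by
          rw [mul_pow, ← Real.rpow_mul_natCast hsq.le, mul_comm γ, Real.rpow_mul hsq.le,
            Real.rpow_natCast, Real.sq_sqrt hS0.le]
      _ ≤ √v ^ 2 := by gcongr
      _ = v := Real.sq_sqrt h0

theorem exists_linearIndependent_noise_le {ι : Type*} [Fintype ι] [Nonempty ι] {h : ι → ℝ}
    (hh : h ≠ 0) {γ c : ℝ} (hγ : γ ≤ 1 - 1 / Fintype.card ι) (hc : 0 < c)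
    (hmin : ∀ S : ℝ, 1 ≤ S → ∀ a : ι → ℤ, a ≠ 0 → ∀ β : ℝ,
      c * S ^ γ ≤ S * (∑ j, (β * h j - (a j : ℝ)) ^ 2) + β ^ 2) :
    ∃ C > 0, ∀ S : ℝ, 1 ≤ S → ∃ a : Fin (Fintype.card ι) → ι → ℤ,
      LinearIndependent ℝ (fun i => fun j => (a i j : ℝ)) ∧ ∀ i, ∃ β : ℝ,
        S * (∑ j, (β * h j - (a i j : ℝ)) ^ 2) + β ^ 2 ≤
          C * S ^ (((Fintype.card ι : ℝ) - 1) * (1 - γ)) := by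
  classical
  obtain ⟨k, hk⟩ := Function.ne_iff.1 hh
  simp only [Pi.zero_apply] at hk
  set n := Fintype.card ι with hn
  have hn0 : 0 < n := Fintype.card_pos
  have hd : ((n - 1 : ℕ) : ℝ) = (n : ℝ) - 1 := by
    rw [Nat.cast_sub hn0]; simp
  have hnR : (1 : ℝ) ≤ n := by exact_mod_cast hn0
  let M : ℝ → (ι → ℝ) →ₗ[ℝ] (ι → ℝ) := fun S => shear k (√S) (fun i => √S * (h i / h k))
  let C₁ : ℝ := n + 1 / h k ^ 2
  have hC₁ : 0 < C₁ := by positivity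
  have hnoise : ∀ S : ℝ, 1 ≤ S → ∀ a : ι → ℤ,
      S * (∑ j, ((a k / h k) * h j - (a j : ℝ)) ^ 2) + (a k / h k) ^ 2 ≤
        C₁ * ‖M S fun j => (a j : ℝ)‖ ^ 2 := by
    intro S hS a
    have hS0 : 0 < S := one_pos.trans_le hS
    have hb : ∀ i, (M S (fun j => (a j : ℝ)) i) ^ 2 ≤ ‖M S fun j => (a j : ℝ)‖ ^ 2 := fun i => by
      rw [← sq_abs, ← Real.norm_eq_abs]
      exact pow_le_pow_left₀ (norm_nonneg _) (norm_le_pi_norm _ i) 2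
    have hj : ∀ j, S * ((a k / h k) * h j - (a j : ℝ)) ^ 2 ≤ ‖M S fun j => (a j : ℝ)‖ ^ 2 := by
      intro j
      by_cases hjk : j = k
      · subst hjk
        rw [div_mul_cancel₀ _ hk, sub_self]
        simp
      · refine le_of_eq_of_le ?_ (hb j)
        simp only [M]
        rw [shear_apply_of_ne hjk]
        nth_rewrite 1 [← Real.sq_sqrt hS0.le]
        ring
    have hkk : (a k / h k) ^ 2 ≤ 1 / h k ^ 2 * ‖M S fun j => (a j : ℝ)‖ ^ 2 := by
      have := hb k
      simp only [M] at this ⊢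
      rw [shear_apply_self] at this
      rw [div_pow, div_mul_eq_mul_div, one_mul]
      gcongr
    rw [Finset.mul_sum]
    have := Finset.sum_le_card_nsmul Finset.univ _ _ fun j _ => hj j
    rw [Finset.card_univ, nsmul_eq_mul] at this
    simp only [C₁, add_mul]
    linarith
  let c₁ := √(c / C₁) / (2 * n)
  have hc₁ : 0 < c₁ := by positivity
  let e := ((n : ℝ) - 1) * (1 - γ) / 2
  let D := 2 / c₁ ^ (n - 1) + n * c₁
  refine ⟨C₁ * D ^ 2, by positivity, fun S hS => ?_⟩
  have hS0 : 0 < S := one_pos.trans_le hS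
  have hsq : 0 < √S := Real.sqrt_pos.2 hS0
  have hdet : LinearMap.det (M S) = √S ^ (n - 1) := det_shear k hsq.ne' _
  have hSg : 0 < S ^ (γ / 2) := by positivity
  have hSe : 0 < S ^ e := by positivity
  have hpow : √S ^ (n - 1) = (S ^ (γ / 2)) ^ (n - 1) * S ^ e := by
    rw [Real.sqrt_eq_rpow, ← Real.rpow_mul_natCast hS0.le, ← Real.rpow_mul_natCast hS0.le,
      ← Real.rpow_add hS0, hd]
    congr 1
    simp only [e]
    ring
  obtain ⟨a, hli, hle⟩ := exists_linearIndependent_norm_le (M S) (L := c₁ * S ^ (γ / 2))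
    (ρ := 2 / c₁ ^ (n - 1) * S ^ e) (by rw [hdet]; positivity) (by positivity) (by positivity)
    (fun a ha => by
      have h1 := (hmin S hS a ha _).trans (hnoise S hS a)
      have h2 : √(c / C₁) * S ^ (γ / 2) ≤ ‖M S fun j => (a j : ℝ)‖ := by
        refine le_of_sq_le_sq ?_ (norm_nonneg _)
        rw [mul_pow, Real.sq_sqrt (by positivity), ← Real.rpow_mul_natCast hS0.le]
        rw [div_mul_eq_mul_div, div_le_iff₀ hC₁, mul_comm _ C₁]
        simpa using h1
      refine lt_of_lt_of_le ?_ h2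
      have h3 : (n : ℝ) * (c₁ * S ^ (γ / 2)) = √(c / C₁) * S ^ (γ / 2) / 2 := by
        simp only [c₁]
        field_simp
      rw [← hn, h3]
      exact half_lt_self (by positivity))
    (by
      have h3 : (c₁ * S ^ (γ / 2)) ^ (n - 1) * (2 / c₁ ^ (n - 1) * S ^ e) =
          2 * √S ^ (n - 1) := by
        rw [hpow, mul_pow]
        field_simp
      rw [← hn, h3, hdet, abs_of_pos (by positivity)]
      linarith [show 0 < √S ^ (n - 1) by positivity])
  refine ⟨a, hli, fun i => ⟨_, (hnoise S hS (a i)).trans ?_⟩⟩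
  have hge : γ / 2 ≤ e := by
    have : (n : ℝ) * γ ≤ n - 1 := by
      have := mul_le_mul_of_nonneg_left hγ (by positivity : (0 : ℝ) ≤ n)
      rwa [mul_sub, mul_one, mul_one_div_cancel (by positivity)] at this
    simp only [e]
    linarith
  have hD : ‖M S fun j => (a i j : ℝ)‖ ≤ D * S ^ e := by
    refine (hle i).trans ?_
    have := Real.rpow_le_rpow_of_exponent_le hS hge
    simp only [D, add_mul, ← hn]
    have h4 := mul_le_mul_of_nonneg_left this (by positivity : 0 ≤ (n : ℝ) * c₁)
    linarith
  calc C₁ * ‖M S fun j => (a i j : ℝ)‖ ^ 2 ≤ C₁ * (D * S ^ e) ^ 2 := by gcongr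
    _ = C₁ * D ^ 2 * S ^ (((n : ℝ) - 1) * (1 - γ)) := by
      rw [mul_pow, ← Real.rpow_mul_natCast hS0.le]
      simp only [e]
      rw [Nat.cast_ofNat, div_mul_cancel₀ _ (two_ne_zero)]
      ring

theorem tendsto_affine_logb_div_logb_one_add (α B : ℝ) :
    Filter.Tendsto (fun S : ℝ =>
      ((1 / 2 : ℝ) * (α * Real.logb 2 S + B)) / ((1 / 2 : ℝ) * Real.logb 2 (1 + S)))
      Filter.atTop (nhds α) := by
  have hlog : Filter.Tendsto (fun S : ℝ => Real.logb 2 (1 + S)) Filter.atTop Filter.atTop :=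
    (Real.tendsto_logb_atTop one_lt_two).comp
      (Filter.tendsto_atTop_add_const_left _ 1 Filter.tendsto_id)
  have hdiff : Filter.Tendsto (fun S : ℝ => Real.logb 2 S - Real.logb 2 (1 + S))
      Filter.atTop (nhds 0) := by
    have h1 : Filter.Tendsto (fun S : ℝ => S / (1 + S)) Filter.atTop (nhds 1) := by
      have h2 : Filter.Tendsto (fun S : ℝ => 1 - (1 + S)⁻¹) Filter.atTop (nhds (1 - 0)) :=
        tendsto_const_nhds.sub (tendsto_inv_atTop_zero.comp
          (Filter.tendsto_atTop_add_const_left _ 1 Filter.tendsto_id))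
      rw [sub_zero] at h2
      refine h2.congr' ?_
      filter_upwards [Filter.eventually_ge_atTop 1] with S hS
      field_simp
      ring
    have h3 := (Real.continuousAt_logb (b := 2) one_ne_zero).tendsto.comp h1
    rw [Real.logb_one] at h3
    refine h3.congr' ?_
    filter_upwards [Filter.eventually_ge_atTop 1] with S hS
    exact Real.logb_div (by positivity) (by positivity)
  have h4 : Filter.Tendsto (fun S : ℝ =>
      α + (α * (Real.logb 2 S - Real.logb 2 (1 + S)) + B) / Real.logb 2 (1 + S))
      Filter.atTop (nhds (α + 0)) :=
    tendsto_const_nhds.add (((hdiff.const_mul α).add_const B).div_atTop hlog)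
  rw [add_zero] at h4
  refine h4.congr' ?_
  filter_upwards [hlog.eventually_gt_atTop 0] with S hS
  field_simp
  ring

/-- A function squeezed between affine functions of `logb 2 S` with slopes arbitrarily close to
`l` grows like `l * logb 2 (1 + S)`. -/
theorem tendsto_div_logb_one_add {f : ℝ → ℝ} {l : ℝ}
    (hlower : ∀ x < l, ∃ α > x, ∃ B : ℝ, ∀ S : ℝ, 1 ≤ S →
      (1 / 2 : ℝ) * (α * Real.logb 2 S + B) ≤ f S)
    (hupper : ∀ x > l, ∃ α < x, ∃ B : ℝ, ∀ S : ℝ, 1 ≤ S →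
      f S ≤ (1 / 2 : ℝ) * (α * Real.logb 2 S + B)) :
    Filter.Tendsto (fun S : ℝ => f S / ((1 / 2 : ℝ) * Real.logb 2 (1 + S)))
      Filter.atTop (nhds l) := by
  have hpos : ∀ S : ℝ, 1 ≤ S → 0 < (1 / 2 : ℝ) * Real.logb 2 (1 + S) := fun S hS =>
    mul_pos (by norm_num) (Real.logb_pos one_lt_two (by linarith))
  refine tendsto_order.2 ⟨fun x hx => ?_, fun x hx => ?_⟩
  · obtain ⟨α, hα, B, hB⟩ := hlower x hx
    filter_upwards [(tendsto_affine_logb_div_logb_one_add α B).eventually_const_lt hα,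
      Filter.eventually_ge_atTop 1] with S h1 hS
    exact h1.trans_le (div_le_div_of_nonneg_right (hB S hS) (hpos S hS).le)
  · obtain ⟨α, hα, B, hB⟩ := hupper x hx
    filter_upwards [(tendsto_affine_logb_div_logb_one_add α B).eventually_lt_const hα,
      Filter.eventually_ge_atTop 1] with S h1 hS
    exact (div_le_div_of_nonneg_right (hB S hS) (hpos S hS).le).trans_lt h1

/-- The `m`-th optimal computation rate. -/
noncomputable def optimalRate {K : ℕ} (h : Fin K → ℝ) (m : ℕ) (S : ℝ) : ℝ :=
  ⨆ a : {a : Fin m → Fin K → ℤ // LinearIndependent ℝ (fun i => fun j => ((a i j : ℝ)))},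
    ⨅ i : Fin m, (1 / 2 : ℝ) * Real.logb 2 (S /
      (⨅ β : ℝ, S * (∑ j, (β * h j - (a.1 i j : ℝ)) ^ 2) + β ^ 2))

section optimalRate

variable {K m : ℕ} {h : Fin K → ℝ} {γ c : ℝ}

theorem half_logb_div_le (hc : 0 < c)
    (hmin : ∀ S : ℝ, 1 ≤ S → ∀ a : Fin K → ℤ, a ≠ 0 → ∀ β : ℝ,
      c * S ^ γ ≤ S * (∑ j, (β * h j - (a j : ℝ)) ^ 2) + β ^ 2)
    {S : ℝ} (hS : 1 ≤ S) {a : Fin K → ℤ} (ha : a ≠ 0) :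
    (1 / 2 : ℝ) * Real.logb 2 (S / (⨅ β : ℝ, S * (∑ j, (β * h j - (a j : ℝ)) ^ 2) + β ^ 2)) ≤
      (1 / 2 : ℝ) * ((1 - γ) * Real.logb 2 S + -Real.logb 2 c) := by
  have hS0 : 0 < S := one_pos.trans_le hS
  have hSg : 0 < S ^ γ := by positivity
  have hle := le_ciInf (hmin S hS a ha)
  have hQ := (mul_pos hc hSg).trans_le hle
  rw [Real.logb_div hS0.ne' hQ.ne']
  have := Real.logb_le_logb_of_le one_lt_two (mul_pos hc hSg) hle
  rw [Real.logb_mul hc.ne' hSg.ne', Real.logb_rpow_eq_mul_logb_of_pos hS0] at this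
  linarith

theorem iInf_half_logb_div_le (hm : 1 ≤ m) (hc : 0 < c)
    (hmin : ∀ S : ℝ, 1 ≤ S → ∀ a : Fin K → ℤ, a ≠ 0 → ∀ β : ℝ,
      c * S ^ γ ≤ S * (∑ j, (β * h j - (a j : ℝ)) ^ 2) + β ^ 2)
    {S : ℝ} (hS : 1 ≤ S) {a : Fin m → Fin K → ℤ}
    (ha : LinearIndependent ℝ (fun i => fun j => ((a i j : ℝ)))) :
    (⨅ i : Fin m, (1 / 2 : ℝ) * Real.logb 2 (S /
      (⨅ β : ℝ, S * (∑ j, (β * h j - (a i j : ℝ)) ^ 2) + β ^ 2))) ≤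
      (1 / 2 : ℝ) * ((1 - γ) * Real.logb 2 S + -Real.logb 2 c) := by
  refine (ciInf_le (Set.finite_range _).bddBelow (⟨0, hm⟩ : Fin m)).trans
    (half_logb_div_le hc hmin hS fun h0 => ha.ne_zero ⟨0, hm⟩ ?_)
  funext j
  simp [h0]

theorem optimalRate_le (hm : 1 ≤ m) (hmK : m ≤ K) (hc : 0 < c)
    (hmin : ∀ S : ℝ, 1 ≤ S → ∀ a : Fin K → ℤ, a ≠ 0 → ∀ β : ℝ,
      c * S ^ γ ≤ S * (∑ j, (β * h j - (a j : ℝ)) ^ 2) + β ^ 2)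
    {S : ℝ} (hS : 1 ≤ S) :
    optimalRate h m S ≤ (1 / 2 : ℝ) * ((1 - γ) * Real.logb 2 S + -Real.logb 2 c) := by
  have : Nonempty {a : Fin m → Fin K → ℤ //
      LinearIndependent ℝ (fun i => fun j => ((a i j : ℝ)))} := by
    refine ⟨fun i => Pi.single (Fin.castLE hmK i) 1, ?_⟩
    convert (Pi.linearIndependent_single_one (Fin K) ℝ).comp _ (Fin.castLE_injective hmK)
      using 1
    funext i j
    simp [Pi.single_apply]
  exact ciSup_le fun a => iInf_half_logb_div_le hm hc hmin hS a.2

theorem exists_le_optimalRate (hm : 1 ≤ m) (hmK : m ≤ K) (hh : h ≠ 0)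
    (hγ : γ ≤ 1 - 1 / K) (hc : 0 < c)
    (hmin : ∀ S : ℝ, 1 ≤ S → ∀ a : Fin K → ℤ, a ≠ 0 → ∀ β : ℝ,
      c * S ^ γ ≤ S * (∑ j, (β * h j - (a j : ℝ)) ^ 2) + β ^ 2) :
    ∃ B : ℝ, ∀ S : ℝ, 1 ≤ S →
      (1 / 2 : ℝ) * ((1 - ((K : ℝ) - 1) * (1 - γ)) * Real.logb 2 S + B) ≤
        optimalRate h m S := by
  have : Nonempty (Fin K) := ⟨⟨0, hm.trans hmK⟩⟩
  have : Nonempty (Fin m) := ⟨⟨0, hm⟩⟩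
  obtain ⟨C, hC, hfam⟩ := exists_linearIndependent_noise_le hh
    (by rwa [Fintype.card_fin]) hc hmin
  simp only [Fintype.card_fin] at hfam
  refine ⟨-Real.logb 2 C, fun S hS => ?_⟩
  have hS0 : 0 < S := one_pos.trans_le hS
  obtain ⟨a, hli, ha⟩ := hfam S hS
  have hcard : K = Fintype.card (Fin K) := (Fintype.card_fin K).symm
  let φ : Fin m → Fin (Fintype.card (Fin K)) := fun i => Fin.cast hcard (Fin.castLE hmK i)
  have hφ : Function.Injective φ :=
    (Fin.cast_injective hcard).comp (Fin.castLE_injective hmK)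
  have hbdd : BddAbove (Set.range fun a : {a : Fin m → Fin K → ℤ //
      LinearIndependent ℝ (fun i => fun j => ((a i j : ℝ)))} =>
      ⨅ i : Fin m, (1 / 2 : ℝ) * Real.logb 2 (S /
        (⨅ β : ℝ, S * (∑ j, (β * h j - (a.1 i j : ℝ)) ^ 2) + β ^ 2))) := by
    refine ⟨(1 / 2 : ℝ) * ((1 - γ) * Real.logb 2 S + -Real.logb 2 c), ?_⟩
    rintro _ ⟨a, rfl⟩
    exact iInf_half_logb_div_le hm hc hmin hS a.2
  refine le_trans ?_ (le_ciSup hbdd ⟨fun i => a (φ i), hli.comp φ hφ⟩)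
  refine le_ciInf fun i => ?_
  obtain ⟨β, hβ⟩ := ha (φ i)
  have ha0 : a (φ i) ≠ 0 := fun h0 => hli.ne_zero (φ i) (by
    funext j
    simp [h0])
  have hQ := (mul_pos hc (Real.rpow_pos_of_pos hS0 γ)).trans_le
    (le_ciInf (hmin S hS _ ha0))
  have hQle := (ciInf_le ⟨_, Set.forall_mem_range.2 (hmin S hS _ ha0)⟩ β).trans hβ
  have hSe : 0 < S ^ (((K : ℝ) - 1) * (1 - γ)) := by positivity
  have := Real.logb_le_logb_of_le one_lt_two hQ hQle
  rw [Real.logb_mul hC.ne' hSe.ne', Real.logb_rpow_eq_mul_logb_of_pos hS0] at this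
  rw [Real.logb_div hS0.ne' hQ.ne']
  linarith

end optimalRate

/-- For Lebesgue-almost every `h ∈ ℝ^K` and every `m ∈ {1,…,K}`, the `m`-th optimal
computation rate `R_m(h; SNR)` (the best worst-case rate over families of `m` integer
coefficient vectors that are linearly independent over `ℝ`) satisfies
`R_m(h;SNR)/((1/2)·log₂(1+SNR)) → 1/K` as `SNR → ∞`. -/
theorem stmt14 (K : ℕ) (hK : 1 ≤ K) :
    ∀ᵐ h : Fin K → ℝ ∂volume,
      ∀ m : ℕ, 1 ≤ m → m ≤ K →
        Filter.Tendsto (fun SNR : ℝ =>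
            (⨆ a : {a : Fin m → Fin K → ℤ //
                LinearIndependent ℝ (fun i => fun j => ((a i j : ℝ)))},
              ⨅ i : Fin m,
                (1 / 2 : ℝ) * Real.logb 2 (SNR /
                  (⨅ β : ℝ, SNR * (∑ j, (β * h j - (a.1 i j : ℝ)) ^ 2) + β ^ 2)))
              / ((1 / 2 : ℝ) * Real.logb 2 (1 + SNR)))
          Filter.atTop (nhds (1 / K)) := by
  have : Nonempty (Fin K) := ⟨⟨0, hK⟩⟩
  have hKR : (1 : ℝ) ≤ K := by exact_mod_cast hK
  have hne : ∀ᵐ h : Fin K → ℝ, h ≠ 0 := compl_mem_ae_iff.2 (measure_singleton 0)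
  have hbound : ∀ᵐ h : Fin K → ℝ, ∀ n : ℕ, ∃ c > 0, ∀ S : ℝ, 1 ≤ S → ∀ a : Fin K → ℤ, a ≠ 0 →
      ∀ β : ℝ, c * S ^ (1 - 1 / (K : ℝ) - 1 / ((n : ℝ) + 1)) ≤
        S * (∑ j, (β * h j - (a j : ℝ)) ^ 2) + β ^ 2 :=
    ae_all_iff.2 fun n => ae_exists_forall_le_noise (by
      rw [Fintype.card_fin]
      linarith [Nat.one_div_pos_of_nat (α := ℝ) (n := n)])
  filter_upwards [hne, hbound] with h hh hmin m hm hmK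
  refine tendsto_div_logb_one_add (f := optimalRate h m) (fun x hx => ?_) (fun x hx => ?_)
  · obtain ⟨n, hn⟩ := exists_nat_one_div_lt (div_pos (sub_pos.2 hx) (by linarith : (0 : ℝ) < K))
    obtain ⟨c, hc, hcm⟩ := hmin n
    have hpos := Nat.one_div_pos_of_nat (α := ℝ) (n := n)
    refine ⟨_, ?_, exists_le_optimalRate hm hmK hh (by linarith) hc hcm⟩
    rw [lt_div_iff₀ (by linarith)] at hn
    have : (K : ℝ) * (1 / K) = 1 := mul_one_div_cancel (by linarith)
    nlinarith
  · obtain ⟨n, hn⟩ := exists_nat_one_div_lt (sub_pos.2 hx)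
    obtain ⟨c, hc, hcm⟩ := hmin n
    exact ⟨_, by linarith, _, fun S hS => optimalRate_le hm hmK hc hcm hS⟩
end
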